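/- arXiv:1409.1968 — 9 statements merged into one kernel-verified Lean document; each statement's English description precedes it below -/
import Mathlib

section
/- For all positive real numbers a and b and every real number r with 0 ≤ r ≤ e, the inequality a^(r·a) + b^(r·b) ≥ a^(r·b) + b^(r·a) holds. -/
open Real

theorem sinh_le_mul_exp_sq_div_six {y : ℝ} (hy : 0 ≤ y) : sinh y ≤ y * exp (y ^ 2 / 6) := by
  have hexp : HasSum (fun n : ℕ => y * ((y ^ 2 / 6) ^ n / n.factorial)) (y * exp (y ^ 2 / 6)) := by
    rw [Real.exp_eq_exp_ℝ]
    exact (NormedSpace.expSeries_div_hasSum_exp (y ^ 2 / 6)).mul_left y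
  refine hasSum_le (fun n => ?_) (hasSum_sinh y) hexp
  have hfac : (6 : ℝ) ^ n * n.factorial ≤ (2 * n + 1).factorial := by
    induction n with
    | zero => simp
    | succ k ih =>
      rw [show 2 * (k + 1) + 1 = (2 * k + 1) + 1 + 1 by ring,
        Nat.factorial_succ (2 * k + 1 + 1), Nat.factorial_succ (2 * k + 1), Nat.factorial_succ k]
      push_cast
      have hk : (0 : ℝ) ≤ k := Nat.cast_nonneg k
      have h0 : (0 : ℝ) ≤ (2 * k + 1).factorial := Nat.cast_nonneg _
      calc (6 : ℝ) ^ (k + 1) * ((k + 1) * k.factorial)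
          = 6 * (k + 1) * (6 ^ k * k.factorial) := by ring
        _ ≤ 6 * (k + 1) * (2 * k + 1).factorial := by gcongr
        _ ≤ ((2 * k + 1 + 1 + 1) * (2 * k + 1 + 1)) * (2 * k + 1).factorial :=
            mul_le_mul_of_nonneg_right (by nlinarith) h0
        _ = _ := by ring
  calc y ^ (2 * n + 1) / ((2 * n + 1).factorial : ℝ)
      ≤ y ^ (2 * n + 1) / (6 ^ n * n.factorial) := by gcongr
    _ = y * ((y ^ 2 / 6) ^ n / n.factorial) := by
        rw [div_pow, ← pow_mul, pow_succ]
        field_simp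

theorem sinh_mul_le {θ x : ℝ} (hθ : 0 ≤ θ) (hθ1 : θ ≤ 1) (hx : 0 ≤ x) :
    sinh (θ * x) ≤ θ * sinh x := by
  refine hasSum_le (fun n => ?_) (hasSum_sinh (θ * x)) ((hasSum_sinh x).mul_left θ)
  rw [mul_pow, mul_div_assoc]
  gcongr
  simpa using pow_le_pow_of_le_one hθ hθ1 (Nat.le_add_left 1 (2 * n))

theorem div_exp_sub_one_le {x : ℝ} (hx : 0 < x) :
    x / (exp x - 1) ≤ 1 - x / 2 + x ^ 2 / 12 := by
  have h := sum_le_exp_of_nonneg hx.le 6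
  simp only [Finset.sum_range_succ, Finset.sum_range_zero, Nat.factorial] at h
  norm_num at h
  have hpos : 0 < exp x - 1 := by linarith [add_one_lt_exp hx.ne']
  rw [div_le_iff₀ hpos]
  have hquad : 0 ≤ 1 - x / 2 + x ^ 2 / 12 := by nlinarith [sq_nonneg (x - 3)]
  have hsum : x + x ^ 2 / 2 + x ^ 3 / 6 + x ^ 4 / 24 + x ^ 5 / 120 ≤ exp x - 1 := by linarith
  have hcub : 0 ≤ x ^ 5 * (2 - x + x ^ 2) :=
    mul_nonneg (by positivity) (by nlinarith [sq_nonneg (x - 1)])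
  nlinarith [mul_le_mul_of_nonneg_left hsum hquad]

theorem log_one_sub_exp_neg_le {x : ℝ} (hx : 0 < x) :
    log (1 - exp (-x)) ≤ log x - x / 2 + x ^ 2 / 24 := by
  have hpos : 0 < 1 - exp (-x) := by linarith [exp_lt_one_iff.2 (neg_lt_zero.2 hx)]
  have hs := sinh_le_mul_exp_sq_div_six (y := x / 2) (by positivity)
  rw [log_le_iff_le_exp hpos,
    show log x - x / 2 + x ^ 2 / 24 = log x + (-(x / 2) + (x / 2) ^ 2 / 6) by ring, exp_add,
    exp_log hx, exp_add]
  have he : 1 - exp (-x) = 2 * exp (-(x / 2)) * sinh (x / 2) := by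
    have h1 : exp (-(x / 2)) * exp (x / 2) = 1 := by rw [← exp_add]; simp
    have h2 : exp (-(x / 2)) * exp (-(x / 2)) = exp (-x) := by rw [← exp_add]; ring_nf
    rw [sinh_eq, ← h2]
    linear_combination -h1
  rw [he]
  nlinarith [mul_le_mul_of_nonneg_left hs (exp_pos (-(x / 2))).le]

/-- Tangent line bound at `q = 1` for the concave function
`q ↦ log ((1 - exp (-q x)) / (1 - exp (-q y)))`. -/
theorem log_one_sub_exp_sub_le_tangent {x y q : ℝ} (hx : 0 < x) (hxy : x ≤ y) (hq : 1 ≤ q) :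
    log (1 - exp (-(q * x))) - log (1 - exp (-(q * y))) ≤
      log (1 - exp (-x)) - log (1 - exp (-y)) +
        (q - 1) * (x / (exp x - 1) - y / (exp y - 1)) := by
  have hy : 0 < y := hx.trans_le hxy
  have hone (w s : ℝ) (hw : 0 < w) (hs : 0 < s) : 0 < exp (s * w) - 1 := by
    linarith [one_lt_exp_iff.2 (mul_pos hs hw)]
  have hone' (w s : ℝ) (hw : 0 < w) (hs : 0 < s) : 0 < 1 - exp (-(s * w)) := by
    linarith [exp_lt_one_iff.2 (neg_lt_zero.2 (mul_pos hs hw))]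
  have hderiv (w s : ℝ) (hw : 0 < w) (hs : 0 < s) :
      HasDerivAt (fun s => w / (exp (s * w) - 1)) (-(w / (2 * sinh (s * w / 2))) ^ 2) s := by
    have h := (((((hasDerivAt_id s).mul_const w).exp).sub_const 1).fun_inv
      (hone w s hw hs).ne').const_mul w
    have hE : exp (s * w) = exp (s * w / 2) ^ 2 := by rw [← exp_nat_mul]; ring_nf
    have h1 : exp (s * w / 2) ^ 2 - 1 ≠ 0 := by rw [← hE]; exact (hone w s hw hs).ne'
    refine h.congr_deriv ?_
    rw [sinh_eq, exp_neg]
    simp only [id, hE]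
    have h0 := (exp_pos (s * w / 2)).ne'
    field_simp
  have hanti (s : ℝ) (hs : 1 ≤ s) :
      x / (exp (s * x) - 1) - y / (exp (s * y) - 1) ≤ x / (exp x - 1) - y / (exp y - 1) := by
    have h : AntitoneOn (fun s => x / (exp (s * x) - 1) - y / (exp (s * y) - 1)) (Set.Ici 1) := by
      have hd (s : ℝ) (hs : 1 ≤ s) :=
        (hderiv x s hx (by linarith)).sub (hderiv y s hy (by linarith))
      refine antitoneOn_of_hasDerivWithinAt_nonpos (convex_Ici 1)
        (fun s hs => (hd s hs).continuousAt.continuousWithinAt)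
        (fun s hs => (hd s (interior_subset hs)).hasDerivWithinAt) fun s hs => ?_
      have hs1 : (1 : ℝ) ≤ s := interior_subset hs
      have hsx : 0 < sinh (s * x / 2) := sinh_pos_iff.2 (by positivity)
      have hsy : 0 < sinh (s * y / 2) := sinh_pos_iff.2 (by positivity)
      have hm := sinh_mul_le (θ := x / y) (x := s * y / 2) (by positivity)
        ((div_le_one hy).2 hxy) (by positivity)
      rw [show x / y * (s * y / 2) = s * x / 2 by field_simp, div_mul_eq_mul_div,
        le_div_iff₀ hy] at hm
      have : y / (2 * sinh (s * y / 2)) ≤ x / (2 * sinh (s * x / 2)) := by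
        rw [div_le_div_iff₀ (by positivity) (by positivity)]
        linarith
      have := pow_le_pow_left₀ (by positivity) this 2
      linarith
    simpa using h (Set.mem_Ici.2 le_rfl) (Set.mem_Ici.2 hs) hs
  have hlog (w s : ℝ) (hw : 0 < w) (hs : 0 < s) :
      HasDerivAt (fun s => log (1 - exp (-(s * w)))) (w / (exp (s * w) - 1)) s := by
    have h := ((((hasDerivAt_id s).mul_const w).fun_neg.exp).const_sub 1).log (hone' w s hw hs).ne'
    refine h.congr_deriv ?_
    have h1 := (hone w s hw hs).ne'
    have h2 := (hone' w s hw hs).ne'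
    simp only [id]
    rw [exp_neg] at h2 ⊢
    have h0 := (exp_pos (s * w)).ne'
    field_simp
  have h : AntitoneOn (fun s => log (1 - exp (-(s * x))) - log (1 - exp (-(s * y))) -
      s * (x / (exp x - 1) - y / (exp y - 1))) (Set.Ici 1) := by
    have hd (s : ℝ) (hs : 1 ≤ s) :=
      ((hlog x s hx (by linarith)).sub (hlog y s hy (by linarith))).sub
        ((hasDerivAt_id s).mul_const (x / (exp x - 1) - y / (exp y - 1)))
    refine antitoneOn_of_hasDerivWithinAt_nonpos (convex_Ici 1)
      (fun s hs => (hd s hs).continuousAt.continuousWithinAt)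
      (fun s hs => (hd s (interior_subset hs)).hasDerivWithinAt) fun s hs => ?_
    have := hanti s (interior_subset hs)
    linarith
  have := h (Set.mem_Ici.2 le_rfl) (Set.mem_Ici.2 hq) hq
  simp only [one_mul] at this
  linarith

theorem le_log_one_add_div_one_sub {z : ℝ} (hz : 0 ≤ z) (hz1 : z < 1) :
    2 * (z + z ^ 3 / 3 + z ^ 5 / 5 + z ^ 7 / 7) ≤ log ((1 + z) / (1 - z)) := by
  have h := sum_range_le_log_div hz hz1 4
  simp only [Finset.sum_range_succ, Finset.sum_range_zero] at h
  norm_num at h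
  linarith

theorem log_log_one_add_div_one_sub_div_le {z : ℝ} (hz : 0 < z) (hz1 : z ≤ 3 / 5) :
    log (log ((1 + z) / (1 - z)) / (2 * z)) ≤ z ^ 2 / 3 + 23 / 100 * z ^ 4 := by
  have hlow := le_log_one_add_div_one_sub hz.le (by linarith)
  have hL : 0 < log ((1 + z) / (1 - z)) := lt_of_lt_of_le (by positivity) hlow
  have h := log_div_le_sum_range_add hz.le (by linarith) 7
  simp only [Finset.sum_range_succ, Finset.sum_range_zero] at h
  norm_num at h
  have hu : z ^ 2 ≤ 9 / 25 := by nlinarith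
  have hrem : z ^ 15 / (1 - z ^ 2) ≤ 25 / 16 * z ^ 15 := by
    rw [div_le_iff₀ (by linarith)]
    have : 0 ≤ z ^ 15 := by positivity
    nlinarith
  have h6 : z ^ 7 ≤ 9 / 25 * z ^ 5 := by
    nlinarith [mul_le_mul_of_nonneg_left hu (pow_nonneg hz.le 5)]
  have h8 : z ^ 9 ≤ 9 / 25 * z ^ 7 := by
    nlinarith [mul_le_mul_of_nonneg_left hu (pow_nonneg hz.le 7)]
  have h10 : z ^ 11 ≤ 9 / 25 * z ^ 9 := by
    nlinarith [mul_le_mul_of_nonneg_left hu (pow_nonneg hz.le 9)]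
  have h12 : z ^ 13 ≤ 9 / 25 * z ^ 11 := by
    nlinarith [mul_le_mul_of_nonneg_left hu (pow_nonneg hz.le 11)]
  have h14 : z ^ 15 ≤ 9 / 25 * z ^ 13 := by
    nlinarith [mul_le_mul_of_nonneg_left hu (pow_nonneg hz.le 13)]
  rw [log_le_iff_le_exp (by positivity)]
  have hp : 0 ≤ z ^ 2 / 3 + 23 / 100 * z ^ 4 := by positivity
  have hsq : z ^ 4 / 9 ≤ (z ^ 2 / 3 + 23 / 100 * z ^ 4) ^ 2 := by
    have : (z ^ 2 / 3) ^ 2 ≤ (z ^ 2 / 3 + 23 / 100 * z ^ 4) ^ 2 :=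
      pow_le_pow_left₀ (by positivity) (le_add_of_nonneg_right (by positivity)) 2
    linarith [show (z ^ 2 / 3) ^ 2 = z ^ 4 / 9 by ring]
  refine le_trans ?_ (quadratic_le_exp_of_nonneg hp)
  rw [div_le_iff₀ (by positivity)]
  have h5 : 0 ≤ z ^ 5 := by positivity
  nlinarith [mul_le_mul_of_nonneg_right hsq hz.le]

theorem log_one_sub_le_sum {z : ℝ} (hz : 0 ≤ z) (hz1 : z < 1) :
    log (1 - z) ≤ -(z + z ^ 2 / 2 + z ^ 3 / 3 + z ^ 4 / 4 + z ^ 5 / 5 + z ^ 6 / 6) := by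
  have h := sum_le_hasSum (Finset.range 6) (fun i _ => by positivity)
    (hasSum_pow_div_log_of_abs_lt_one (abs_lt.2 ⟨by linarith, hz1⟩))
  simp only [Finset.sum_range_succ, Finset.sum_range_zero] at h
  norm_num at h
  linarith

theorem exp_le_quintic {z : ℝ} (hz : 0 ≤ z) (hz1 : z ≤ 1) :
    exp z ≤ 1 + z + z ^ 2 / 2 + z ^ 3 / 6 + z ^ 4 / 24 + z ^ 5 / 100 := by
  have h := exp_bound' hz hz1 (n := 5) (by norm_num)
  simp only [Finset.sum_range_succ, Finset.sum_range_zero, Nat.factorial] at h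
  norm_num at h
  linarith

/-- With `t = (1 - z) / (1 + z)`, the lower Taylor bound for `-(t * log t)`. -/
theorem le_mul_log_one_add_div_one_sub {z : ℝ} (hz : 0 ≤ z) (hz1 : z < 1) :
    (1 - z) / (1 + z) * (2 * (z + z ^ 3 / 3)) ≤
      (1 - z) / (1 + z) * log ((1 + z) / (1 - z)) := by
  have h := le_log_one_add_div_one_sub hz hz1
  have h5 : 0 ≤ z ^ 5 := by positivity
  have h7 : 0 ≤ z ^ 7 := by positivity
  have : 0 ≤ (1 - z) / (1 + z) := div_nonneg (by linarith) (by linarith)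
  gcongr
  linarith

theorem mul_log_one_add_div_one_sub_le_one {z : ℝ} (hz : 0 ≤ z) (hz1 : z < 1) :
    (1 - z) / (1 + z) * log ((1 + z) / (1 - z)) ≤ 1 := by
  have h1 : 0 < 1 - z := by linarith
  have h := log_le_sub_one_of_pos (show 0 < (1 + z) / (1 - z) by positivity)
  calc (1 - z) / (1 + z) * log ((1 + z) / (1 - z))
      ≤ (1 - z) / (1 + z) * ((1 + z) / (1 - z) - 1) := by gcongr
    _ = 1 - (1 - z) / (1 + z) := by field_simp
    _ ≤ 1 := by linarith [show 0 ≤ (1 - z) / (1 + z) by positivity]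

theorem div_exp_sub_one_sub_div_le {z t x : ℝ} (hz : 0 < z) (hz1 : z < 1) (ht : t = (1 - z) / (1 + z))
    (hx : x = t * log ((1 + z) / (1 - z))) :
    x / (exp x - 1) - x / (1 - t) ≤ (1 - t) * z := by
  have hlow := le_mul_log_one_add_div_one_sub hz.le hz1
  have hup := mul_log_one_add_div_one_sub_le_one hz.le hz1
  rw [← ht, ← hx] at hlow hup
  have h1z : 0 < 1 - z := by linarith
  set y := t * (2 * (z + z ^ 3 / 3)) with hy
  have ht0 : 0 < t := by rw [ht]; positivity
  have hy0 : 0 < y := by positivity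
  have hE := div_exp_sub_one_le (hy0.trans_le hlow)
  have h1t : 1 - t = 2 * z / (1 + z) := by rw [ht]; field_simp; ring
  have hmono : -x / 2 + x ^ 2 / 12 ≤ -y / 2 + y ^ 2 / 12 := by nlinarith
  have hdiv : y / (1 - t) ≤ x / (1 - t) := by
    have : 0 < 1 - t := by rw [h1t]; positivity
    gcongr
  suffices 1 - y / 2 + y ^ 2 / 12 - y / (1 - t) ≤ (1 - t) * z by linarith
  have hpoly : 0 ≤ z ^ 3 * (4 / 3 - 8 / 9 * z - 2 / 9 * z ^ 2 - 7 / 27 * z ^ 3 + 2 / 27 * z ^ 4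
      - 1 / 27 * z ^ 5) := by
    refine mul_nonneg (by positivity) ?_
    have hquart : 0 ≤ (1 - z) * (36 + 12 * z + 6 * z ^ 2 - z ^ 3 + z ^ 4) := by
      have : z ^ 3 ≤ 1 := pow_le_one₀ hz.le hz1.le
      have : 0 ≤ 36 + 12 * z + 6 * z ^ 2 - z ^ 3 + z ^ 4 := by
        linarith [pow_pos hz 2, pow_pos hz 4]
      positivity
    linarith
  rw [← sub_nonneg]
  have : (1 - t) * z - (1 - y / 2 + y ^ 2 / 12 - y / (1 - t)) =
      z ^ 3 * (4 / 3 - 8 / 9 * z - 2 / 9 * z ^ 2 - 7 / 27 * z ^ 3 + 2 / 27 * z ^ 4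
        - 1 / 27 * z ^ 5) / (1 + z) ^ 2 := by
    rw [h1t, hy, ht]
    field_simp
    ring
  rw [this]
  positivity

theorem neg_le_log_one_sub {t : ℝ} (ht0 : 0 ≤ t) (ht4 : t ≤ 1 / 4) :
    -(t + 2 / 3 * t ^ 2) ≤ log (1 - t) := by
  have h1t : 0 < 1 - t := by linarith
  rw [neg_le, ← log_inv, log_le_iff_le_exp (by positivity), inv_le_iff_one_le_mul₀ h1t]
  have := sum_le_exp_of_nonneg (show 0 ≤ t + 2 / 3 * t ^ 2 by positivity) 4
  norm_num [Finset.sum_range_succ, Nat.factorial] at this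
  refine le_trans ?_ (mul_le_mul_of_nonneg_right this h1t.le)
  have e3 : t ^ 3 ≤ 1 / 4 * t ^ 2 := by nlinarith [sq_nonneg t]
  have e4 : t ^ 4 ≤ 1 / 4 * t ^ 3 := by nlinarith [pow_nonneg ht0 3]
  have e5 : t ^ 5 ≤ 1 / 4 * t ^ 4 := by nlinarith [pow_nonneg ht0 4]
  have e6 : t ^ 6 ≤ 1 / 4 * t ^ 5 := by nlinarith [pow_nonneg ht0 5]
  have e7 : t ^ 7 ≤ 1 / 4 * t ^ 6 := by nlinarith [pow_nonneg ht0 6]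
  linarith [sq_nonneg t]

theorem quintic_nonneg {z : ℝ} (hz : 0 ≤ z) (hz1 : z ≤ 3 / 5) :
    0 ≤ 1 / 3 - 341 / 450 * z + 41 / 900 * z ^ 2 + 191 / 540 * z ^ 3 +
      743 / 1350 * z ^ 4 + 4 / 27 * z ^ 5 := by
  have hw : 0 ≤ 3 / 5 - z := by linarith
  linarith [pow_nonneg hw 5, mul_nonneg hz (pow_nonneg hw 4),
    mul_nonneg (pow_nonneg hz 2) (pow_nonneg hw 3),
    mul_nonneg (pow_nonneg hz 3) (pow_nonneg hw 2),
    mul_nonneg (pow_nonneg hz 4) hw, pow_nonneg hz 5]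

theorem nonic_nonneg {z : ℝ} (hz : 3 / 5 ≤ z) (hz1 : z ≤ 1) :
    0 ≤ -(427 / 375) + 3209 / 1500 * z + 73 / 375 * z ^ 2 - 1 / 3 * z ^ 3
      - 10 / 9 * z ^ 4 - 23 / 180 * z ^ 5 + 181 / 2700 * z ^ 6 + 2591 / 9450 * z ^ 7
      + 37 / 189 * z ^ 8 + 3 / 28 * z ^ 9 := by
  obtain ⟨s, rfl⟩ : ∃ s, z = 3 / 5 + s := ⟨z - 3 / 5, by ring⟩
  have hs : 0 ≤ s := by linarith
  have e2 : s ^ 2 ≤ 2 / 5 * s := by nlinarith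
  have e3 : s ^ 3 ≤ 2 / 5 * s ^ 2 := by nlinarith [sq_nonneg s]
  linarith [pow_nonneg hs 4, pow_nonneg hs 5, pow_nonneg hs 6, pow_nonneg hs 7,
    pow_nonneg hs 8, pow_nonneg hs 9]

theorem log_one_sub_exp_neg_mul_log_le {z t x : ℝ} (hz : 0 < z) (hz1 : z < 1)
    (ht : t = (1 - z) / (1 + z)) (hx : x = t * log ((1 + z) / (1 - z))) :
    log (1 - exp (-x)) ≤ log (1 - t) - (1 - t) * (exp z - z) := by
  have hlow := le_mul_log_one_add_div_one_sub hz.le hz1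
  have hup := mul_log_one_add_div_one_sub_le_one hz.le hz1
  have hLlow := le_log_one_add_div_one_sub hz.le hz1
  rw [← ht, ← hx] at hlow hup
  have h1z : 0 < 1 - z := by linarith
  set y := t * (2 * (z + z ^ 3 / 3)) with hy
  set L := log ((1 + z) / (1 - z)) with hL
  have hLpos : 0 < L := lt_of_lt_of_le (by positivity) hLlow
  have ht0 : 0 < t := by rw [ht]; positivity
  have hy0 : 0 < y := by positivity
  have hx0 := hy0.trans_le hlow
  have hE := exp_le_quintic hz.le hz1.le
  have h1t : 1 - t = 2 * z / (1 + z) := by rw [ht]; field_simp; ring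
  have h1tpos : 0 < 1 - t := by rw [h1t]; positivity
  have hmono : -x / 2 + x ^ 2 / 24 ≤ -y / 2 + y ^ 2 / 24 := by nlinarith
  have hlogt : log t = -L := by
    rw [hL, ← log_inv, inv_div, ht]
  have hlogx : log x = -L + log L := by
    rw [hx, log_mul ht0.ne' hLpos.ne', hlogt]
  have hS := log_one_sub_exp_neg_le hx0
  have hexp : (1 - t) * (exp z - z) ≤
      (1 - t) * (1 + z ^ 2 / 2 + z ^ 3 / 6 + z ^ 4 / 24 + z ^ 5 / 100) := by
    gcongr
    linarith
  rcases le_total z (3 / 5) with hz2 | hz2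
  · have hratio := log_log_one_add_div_one_sub_div_le hz hz2
    rw [← hL, log_div hLpos.ne' (by positivity)] at hratio
    have hlog1t : log (1 - t) = log (2 * z) - log (1 + z) := by
      rw [h1t, log_div (by positivity) (by positivity)]
    have hL' : L = log (1 + z) - log (1 - z) := by
      rw [hL, log_div (by positivity) (by positivity)]
    have hlog1z := log_one_sub_le_sum hz.le hz1
    suffices -(z + z ^ 2 / 2 + z ^ 3 / 3 + z ^ 4 / 4 + z ^ 5 / 5 + z ^ 6 / 6) +
        (z ^ 2 / 3 + 23 / 100 * z ^ 4) - y / 2 + y ^ 2 / 24 +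
        (1 - t) * (1 + z ^ 2 / 2 + z ^ 3 / 6 + z ^ 4 / 24 + z ^ 5 / 100) ≤ 0 by linarith
    have hpoly := mul_nonneg (pow_nonneg hz.le 3) (quintic_nonneg hz.le hz2)
    rw [← neg_nonneg]
    have heq : -(-(z + z ^ 2 / 2 + z ^ 3 / 3 + z ^ 4 / 4 + z ^ 5 / 5 + z ^ 6 / 6) +
        (z ^ 2 / 3 + 23 / 100 * z ^ 4) - y / 2 + y ^ 2 / 24 +
        (1 - t) * (1 + z ^ 2 / 2 + z ^ 3 / 6 + z ^ 4 / 24 + z ^ 5 / 100)) =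
        z ^ 3 * (1 / 3 - 341 / 450 * z + 41 / 900 * z ^ 2 + 191 / 540 * z ^ 3 +
        743 / 1350 * z ^ 4 + 4 / 27 * z ^ 5) / (1 + z) ^ 2 := by
      rw [h1t, hy, ht]
      field_simp
      ring
    rw [heq]
    positivity
  · have hlog : log L ≤ 472 / 1000 + (L / (8 / 5) - 1) := by
      have h1 := log_le_sub_one_of_pos (show 0 < L / (8 / 5) by positivity)
      rw [log_div hLpos.ne' (by norm_num)] at h1
      have h2 : log (8 / 5) ≤ 472 / 1000 := by
        rw [log_le_iff_le_exp (by norm_num)]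
        refine le_trans ?_ (sum_le_exp_of_nonneg (by norm_num) 5)
        norm_num [Finset.sum_range_succ, Nat.factorial]
      linarith
    have ht4 : t ≤ 1 / 4 := by
      rw [ht, div_le_iff₀ (by positivity)]
      linarith
    have hlog1t := neg_le_log_one_sub ht0.le ht4
    suffices 472 / 1000 - 1 - 3 / 8 * (2 * (z + z ^ 3 / 3 + z ^ 5 / 5 + z ^ 7 / 7)) +
        (t + 2 / 3 * t ^ 2) - y / 2 + y ^ 2 / 24 +
        (1 - t) * (1 + z ^ 2 / 2 + z ^ 3 / 6 + z ^ 4 / 24 + z ^ 5 / 100) ≤ 0 by linarith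
    have hpoly := nonic_nonneg hz2 hz1.le
    rw [← neg_nonneg]
    have heq : -(472 / 1000 - 1 - 3 / 8 * (2 * (z + z ^ 3 / 3 + z ^ 5 / 5 + z ^ 7 / 7)) +
        (t + 2 / 3 * t ^ 2) - y / 2 + y ^ 2 / 24 +
        (1 - t) * (1 + z ^ 2 / 2 + z ^ 3 / 6 + z ^ 4 / 24 + z ^ 5 / 100)) =
        (-(427 / 375) + 3209 / 1500 * z + 73 / 375 * z ^ 2 - 1 / 3 * z ^ 3
        - 10 / 9 * z ^ 4 - 23 / 180 * z ^ 5 + 181 / 2700 * z ^ 6 + 2591 / 9450 * z ^ 7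
        + 37 / 189 * z ^ 8 + 3 / 28 * z ^ 9) / (1 + z) ^ 2 := by
      rw [h1t, hy, ht]
      field_simp
      ring
    rw [heq]
    positivity

theorem log_one_sub_rpow_sub_log_le {t q : ℝ} (ht : 0 < t) (ht1 : t < 1) (hq : 1 ≤ q) :
    log (1 - t ^ (q * t)) - log (1 - t ^ q) ≤ (1 - t) * (q * log q - q) := by
  have h1t : 0 < 1 - t := by linarith
  have hz : 0 < (1 - t) / (1 + t) := by positivity
  have hz1 : (1 - t) / (1 + t) < 1 := by rw [div_lt_one (by positivity)]; linarith
  set z := (1 - t) / (1 + t) with hzdef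
  have htz : t = (1 - z) / (1 + z) := by rw [hzdef]; field_simp; ring
  set L := -log t with hL
  have hL' : L = log ((1 + z) / (1 - z)) := by
    rw [hL, ← log_inv, ← inv_div (1 - z), ← htz]
  have hLpos : 0 < L := neg_pos.2 (log_neg ht ht1)
  have hx : t * L = t * log ((1 + z) / (1 - z)) := by rw [hL']
  have hexpL : exp L = t⁻¹ := by rw [hL, exp_neg, exp_log ht]
  have hexpL' : exp (-L) = t := by rw [hL, neg_neg, exp_log ht]
  have hslope := div_exp_sub_one_sub_div_le hz hz1 htz hx
  have hend := log_one_sub_exp_neg_mul_log_le hz hz1 htz hx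
  have htan := log_one_sub_exp_sub_le_tangent (mul_pos ht hLpos)
    (mul_le_of_le_one_left hLpos.le ht1.le) hq
  have hLdiv : L / (exp L - 1) = t * L / (1 - t) := by
    rw [hexpL]; field_simp
  rw [hLdiv, hexpL'] at htan
  rw [rpow_def_of_pos ht, rpow_def_of_pos ht,
    show log t * (q * t) = -(q * (t * L)) by rw [hL]; ring,
    show log t * q = -(q * L) by rw [hL]; ring]
  have hq0 : 0 < q := by linarith
  have hyoung : q - q * log q ≤ exp z - q * z := by
    have h := add_one_le_exp (z - log q)
    rw [exp_sub, exp_log hq0, le_div_iff₀ hq0] at h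
    linarith
  nlinarith [mul_le_mul_of_nonneg_left hslope (sub_nonneg.2 hq),
    mul_le_mul_of_nonneg_left hyoung h1t.le]

/-- Normalised form of the inequality: `t` is the ratio of the two bases. -/
theorem one_sub_rpow_mul_le {t q : ℝ} (ht : 0 < t) (ht1 : t < 1) (hq : 0 < q) :
    1 - t ^ (q * t) ≤ exp ((1 - t) * (q * log q - q)) * (1 - t ^ q) := by
  have hpos (s : ℝ) (hs : 0 < s) : 0 < 1 - t ^ s := sub_pos.2 (rpow_lt_one ht.le ht1 hs)
  have hlarge (s : ℝ) (hs : 1 ≤ s) :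
      1 - t ^ (s * t) ≤ exp ((1 - t) * (s * log s - s)) * (1 - t ^ s) := by
    have h := log_one_sub_rpow_sub_log_le ht ht1 hs
    have h1 := hpos (s * t) (by positivity)
    have h2 := hpos s (by positivity)
    rwa [← log_div h1.ne' h2.ne', log_le_iff_le_exp (by positivity), div_le_iff₀ h2] at h
  rcases le_total 1 q with hq1 | hq1
  · exact hlarge q hq1
  have hone := hlarge 1 le_rfl
  simp only [one_mul, log_one, zero_sub, rpow_one, mul_neg, mul_one] at hone
  have h1t : 0 < 1 - t := by linarith
  have hyt : t ≤ t ^ q := by simpa using rpow_le_rpow_of_exponent_ge ht ht1.le hq1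
  have hy1 := hpos q hq
  rw [rpow_mul ht.le]
  set y := t ^ q
  have hconc := (concaveOn_rpow ht.le ht1.le).2 (Set.mem_Ici.2 ht.le)
    (Set.mem_Ici.2 zero_le_one) (show 0 ≤ (1 - y) / (1 - t) by positivity)
    (show 0 ≤ 1 - (1 - y) / (1 - t) by
      rw [sub_nonneg, div_le_one h1t]; linarith) (by ring)
  have hcomb : (1 - y) / (1 - t) * t + (1 - (1 - y) / (1 - t)) * 1 = y := by
    field_simp; ring
  simp only [smul_eq_mul, hcomb, one_rpow] at hconc
  calc 1 - y ^ t ≤ (1 - y) / (1 - t) * (1 - t ^ t) := by linarith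
    _ ≤ (1 - y) / (1 - t) * (exp (-(1 - t)) * (1 - t)) := by gcongr
    _ = exp (-(1 - t)) * (1 - y) := by field_simp
    _ ≤ exp ((1 - t) * (q * log q - q)) * (1 - y) := by
        gcongr
        have h := one_sub_inv_le_log_of_pos hq
        have : q - 1 ≤ q * log q := by
          calc q - 1 = q * (1 - q⁻¹) := by field_simp
            _ ≤ q * log q := by gcongr
        nlinarith

theorem rpow_add_rpow_le_of_lt_of_lt_one {a b r : ℝ} (hb : 0 < b) (hab : b < a) (ha1 : a < 1)
    (hr : 0 < r) (hre : r ≤ exp 1) :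
    a ^ (r * b) + b ^ (r * a) ≤ a ^ (r * a) + b ^ (r * b) := by
  have ha : 0 < a := hb.trans hab
  have ht1 : b / a < 1 := (div_lt_one ha).2 hab
  have hkey := one_sub_rpow_mul_le (div_pos hb ha) ht1 (mul_pos hr ha)
  have hqt : r * a * (b / a) = r * b := by field_simp
  rw [hqt, div_rpow hb.le ha.le, div_rpow hb.le ha.le] at hkey
  have hexp : exp ((1 - b / a) * (r * a * log (r * a) - r * a)) ≤ a ^ (r * a) / a ^ (r * b) := by
    rw [← rpow_sub ha, rpow_def_of_pos ha, exp_le_exp, log_mul hr.ne' ha.ne']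
    have hlr : log r ≤ 1 := (log_le_iff_le_exp hr).2 hre
    have : (1 - b / a) * (r * a * (log r + log a) - r * a) =
        r * (a - b) * (log a + (log r - 1)) := by field_simp; ring
    rw [this]
    nlinarith [mul_pos hr (sub_pos.2 hab)]
  have hA : 0 < a ^ (r * b) := rpow_pos_of_pos ha _
  have hB : 0 < a ^ (r * a) := rpow_pos_of_pos ha _
  have hC : 0 ≤ 1 - b ^ (r * a) / a ^ (r * a) := by
    rw [sub_nonneg, div_le_one hB]
    exact rpow_le_rpow hb.le hab.le (by positivity)
  have h := hkey.trans (mul_le_mul_of_nonneg_right hexp hC)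
  have h' := mul_le_mul_of_nonneg_left h hA.le
  have e1 : a ^ (r * b) * (1 - b ^ (r * b) / a ^ (r * b)) = a ^ (r * b) - b ^ (r * b) := by
    field_simp
  have e2 : a ^ (r * b) * (a ^ (r * a) / a ^ (r * b) * (1 - b ^ (r * a) / a ^ (r * a))) =
      a ^ (r * a) - b ^ (r * a) := by field_simp
  rw [e1, e2] at h'
  linarith

theorem rpow_add_rpow_le_of_le {a b r : ℝ} (hb : 0 < b) (hab : b ≤ a) (hr0 : 0 ≤ r)
    (hre : r ≤ exp 1) :
    a ^ (r * b) + b ^ (r * a) ≤ a ^ (r * a) + b ^ (r * b) := by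
  have ha : 0 < a := hb.trans_le hab
  have hmul : r * b ≤ r * a := by gcongr
  rcases hr0.eq_or_lt with rfl | hr
  · simp
  rcases hab.eq_or_lt with rfl | hlt
  · rfl
  rcases lt_or_ge a 1 with ha1 | ha1
  · exact rpow_add_rpow_le_of_lt_of_lt_one hb hlt ha1 hr hre
  have hA := rpow_le_rpow_of_exponent_le ha1 hmul
  rcases le_total b 1 with hb1 | hb1
  · linarith [rpow_le_rpow_of_exponent_ge hb hb1 hmul]
  have hsplit (w : ℝ) (hw : 0 < w) : w ^ (r * a) = w ^ (r * b) * w ^ (r * a - r * b) := by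
    rw [← rpow_add hw]; ring_nf
  have h1 : b ^ (r * b) ≤ a ^ (r * b) := rpow_le_rpow hb.le hab (by positivity)
  have h2 : b ^ (r * a - r * b) ≤ a ^ (r * a - r * b) :=
    rpow_le_rpow hb.le hab (sub_nonneg.2 hmul)
  have h3 : 1 ≤ b ^ (r * a - r * b) := one_le_rpow hb1 (sub_nonneg.2 hmul)
  rw [hsplit a ha, hsplit b hb]
  have h0 : 0 ≤ b ^ (r * b) := by positivity
  nlinarith [mul_le_mul h1 (sub_le_sub_right h2 1) (sub_nonneg.2 h3) (h0.trans h1)]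

theorem cirtoaje_two_var (a b r : ℝ) (ha : 0 < a) (hb : 0 < b)
    (hr0 : 0 ≤ r) (hre : r ≤ Real.exp 1) :
    a ^ (r * a) + b ^ (r * b) ≥ a ^ (r * b) + b ^ (r * a) := by
  rcases le_total b a with h | h
  · exact rpow_add_rpow_le_of_le hb h hr0 hre
  · linarith [rpow_add_rpow_le_of_le ha h hr0 hre]
end

section
/- For all real numbers a, b with 0 < a ≤ 1 and 0 < b ≤ 1 and every real number r with 0 ≤ r ≤ e, the inequality 2·√(a^(r·a)·b^(r·b)) ≥ a^(r·b) + b^(r·a) holds. -/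
open Real

/-- A function whose derivative is nonnegative on `[0, b]` is bounded below there by its value
at `0`. -/
lemma apply_zero_le_of_hasDerivAt_nonneg {f f' : ℝ → ℝ} {b : ℝ} (hb : 0 ≤ b)
    (hf : ∀ x, HasDerivAt f (f' x) x) (hf' : ∀ x, 0 ≤ x → x ≤ b → 0 ≤ f' x) : f 0 ≤ f b := by
  have hmono : MonotoneOn f (Set.Icc 0 b) := by
    refine monotoneOn_of_deriv_nonneg (convex_Icc 0 b)
      (fun x _ => (hf x).continuousAt.continuousWithinAt)
      (fun x _ => (hf x).differentiableAt.differentiableWithinAt) fun x hx => ?_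
    rw [interior_Icc] at hx
    rw [(hf x).deriv]
    exact hf' x hx.1.le hx.2.le
  exact hmono ⟨le_rfl, hb⟩ ⟨hb, le_rfl⟩ hb

lemma sinh_le_mul_cosh {x : ℝ} (hx : 0 ≤ x) : sinh x ≤ x * cosh x := by
  have h := apply_zero_le_of_hasDerivAt_nonneg (f := fun y => y * cosh y - sinh y)
    (f' := fun y => y * sinh y) hx
    (fun y => (((hasDerivAt_id y).mul (hasDerivAt_cosh y)).sub (hasDerivAt_sinh y)).congr_deriv
      (by simp))
    (fun y hy _ => mul_nonneg hy (sinh_nonneg_iff.2 hy))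
  simpa using h

lemma mul_cosh_le_mul_sinh {x : ℝ} (hx : 0 ≤ x) : x * cosh x ≤ (1 + x ^ 2 / 3) * sinh x := by
  have h := apply_zero_le_of_hasDerivAt_nonneg
    (f := fun y => (1 + y ^ 2 / 3) * sinh y - y * cosh y)
    (f' := fun y => y / 3 * (y * cosh y - sinh y)) hx
    (fun y => ((((((hasDerivAt_id y).pow 2).div_const 3).const_add 1).mul
      (hasDerivAt_sinh y)).sub ((hasDerivAt_id y).mul (hasDerivAt_cosh y))).congr_deriv
      (by simp; ring))
    (fun y hy _ => mul_nonneg (by positivity) (sub_nonneg.2 (sinh_le_mul_cosh hy)))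
  simpa using h

lemma six_pow_mul_factorial_le (n : ℕ) : 6 ^ n * n.factorial ≤ (2 * n + 1).factorial := by
  induction n with
  | zero => simp
  | succ k ih =>
    have h : (2 * (k + 1) + 1).factorial = (2 * k + 3) * ((2 * k + 2) * (2 * k + 1).factorial) := by
      rw [show 2 * (k + 1) + 1 = 2 * k + 1 + 1 + 1 by ring, Nat.factorial_succ, Nat.factorial_succ]
    rw [h, Nat.factorial_succ, pow_succ]
    calc 6 ^ k * 6 * ((k + 1) * k.factorial) = 6 * (k + 1) * (6 ^ k * k.factorial) := by ring
      _ ≤ (2 * k + 3) * (2 * k + 2) * (2 * k + 1).factorial := Nat.mul_le_mul (by nlinarith) ih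
      _ = _ := by ring

lemma sinh_le_mul_exp {x : ℝ} (hx : 0 ≤ x) : sinh x ≤ x * exp (x ^ 2 / 6) := by
  have hexp : HasSum (fun n : ℕ => x * ((x ^ 2 / 6) ^ n / n.factorial)) (x * exp (x ^ 2 / 6)) := by
    rw [exp_eq_exp_ℝ]
    exact (NormedSpace.expSeries_div_hasSum_exp (x ^ 2 / 6)).mul_left x
  refine hasSum_le (fun n => ?_) (hasSum_sinh x) hexp
  have h : ((6 : ℝ) ^ n * n.factorial) ≤ (2 * n + 1).factorial := by
    exact_mod_cast six_pow_mul_factorial_le n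
  calc x ^ (2 * n + 1) / (2 * n + 1).factorial ≤ x ^ (2 * n + 1) / (6 ^ n * n.factorial) := by
        gcongr
    _ = _ := by rw [div_pow, ← pow_mul, pow_succ]; field_simp

lemma log_sinh_add_le_sq {x : ℝ} (hx : 0 < x) :
    log (sinh x) + x * cosh x / sinh x ≤ 1 + log x + x ^ 2 / 2 := by
  have hS : 0 < sinh x := sinh_pos_iff.2 hx
  have h₁ : x * cosh x / sinh x ≤ 1 + x ^ 2 / 3 :=
    (div_le_iff₀ hS).2 (mul_cosh_le_mul_sinh hx.le)
  have h₂ : log (sinh x) ≤ log x + x ^ 2 / 6 := by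
    have h := log_le_log hS (sinh_le_mul_exp hx.le)
    rwa [log_mul hx.ne' (exp_pos _).ne', log_exp] at h
  linarith

lemma exp_neg_lower_bound (p : ℝ) : 1 - p ^ 2 ≤ 1.26 * exp (-p) := by
  have h : (0.657 : ℝ) ≤ exp (-0.42) := by
    have h' : exp 0.42 ≤ 1 / 0.657 :=
      (exp_bound' (n := 7) (by norm_num) (by norm_num) (by norm_num)).trans
        (by norm_num [Finset.sum_range_succ, Nat.factorial])
    rw [exp_neg, le_inv_comm₀ (by norm_num) (exp_pos _)]
    simpa using h'
  have h₁ : exp (-p) = exp (-0.42) * exp (0.42 - p) := by rw [← exp_add]; congr 1; ring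
  have h₂ := add_one_le_exp (0.42 - p)
  by_cases hp : p ≤ 1.42
  · have h₃ : 0.657 * (0.42 - p + 1) ≤ exp (-0.42) * exp (0.42 - p) :=
      mul_le_mul h h₂ (by linarith) (exp_pos _).le
    nlinarith [sq_nonneg (p - 0.41)]
  · nlinarith [exp_pos (-p)]

lemma log_sinh_add_le_linear {x : ℝ} (hx : 0 < x) :
    log (sinh x) + x * cosh x / sinh x ≤ 2 * x + log 0.63 := by
  have hS : 0 < sinh x := sinh_pos_iff.2 hx
  have hsum : cosh x = sinh x + exp (-x) := by rw [cosh_eq, sinh_eq]; ring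
  have h₁ : x * cosh x / sinh x ≤ x + exp (-x) := by
    rw [div_le_iff₀ hS, hsum]
    nlinarith [self_le_sinh_iff.2 hx.le, exp_pos (-x)]
  have hprod : exp x * exp (-x) = 1 := by rw [← exp_add]; simp
  have h₂ : sinh x ≤ 0.63 * exp (x - exp (-x)) := by
    have h := exp_neg_lower_bound (exp (-x))
    rw [sub_eq_add_neg, exp_add, sinh_eq]
    have hsq : exp x * exp (-x) ^ 2 = exp (-x) := by rw [sq, ← mul_assoc, hprod, one_mul]
    linarith [mul_le_mul_of_nonneg_left h (exp_pos x).le]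
  have h₃ := log_le_log hS h₂
  rw [log_mul (by norm_num) (exp_pos _).ne', log_exp] at h₃
  linarith

lemma cosh_two_mul_add_le_exp {w : ℝ} (hw : 0 ≤ w) (hw1 : w < 1) :
    cosh (2 * w + 2 * w ^ 3 / 3) ≤ exp (2 * w ^ 2) := by
  have key : ∀ y, 0 ≤ y → y ≤ w →
      sinh (2 * y + 2 * y ^ 3 / 3) * (1 + y ^ 2) ≤ 2 * y * cosh (2 * y + 2 * y ^ 3 / 3) := by
    intro y hy hyw
    have hy1 : y < 1 := hyw.trans_lt hw1
    set X := 2 * y + 2 * y ^ 3 / 3 with hX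
    have hlog : X ≤ log (1 + y) - log (1 - y) := by
      have h := sum_le_hasSum (Finset.range 2) (fun i _ => by positivity)
        (hasSum_log_sub_log_of_abs_lt_one (abs_lt.2 ⟨by linarith, hy1⟩))
      norm_num [Finset.sum_range_succ] at h
      linarith
    have hexp : exp X * (1 - y) ≤ 1 + y := by
      have h := exp_le_exp.2 hlog
      rw [exp_sub, exp_log (by linarith), exp_log (by linarith)] at h
      exact (le_div_iff₀ (by linarith)).1 h
    have hprod : exp X * exp (-X) = 1 := by rw [← exp_add]; simp
    have hexp' : 1 - y ≤ exp (-X) * (1 + y) := by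
      nlinarith [mul_le_mul_of_nonneg_left hexp (exp_pos (-X)).le]
    rw [sinh_eq, cosh_eq]
    nlinarith [mul_le_mul_of_nonneg_right hexp (by linarith : 0 ≤ 1 - y),
      mul_le_mul_of_nonneg_right hexp' (by linarith : 0 ≤ 1 + y)]
  have hd : ∀ y : ℝ, HasDerivAt (fun y => -(exp (-(2 * y ^ 2)) * cosh (2 * y + 2 * y ^ 3 / 3)))
      (2 * exp (-(2 * y ^ 2)) * (2 * y * cosh (2 * y + 2 * y ^ 3 / 3) -
        sinh (2 * y + 2 * y ^ 3 / 3) * (1 + y ^ 2))) y := by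
    intro y
    have h₁ : HasDerivAt (fun y : ℝ => -(2 * y ^ 2)) (-(4 * y)) y :=
      (((hasDerivAt_id y).pow 2).const_mul 2).neg.congr_deriv (by simp; ring)
    have h₂ : HasDerivAt (fun y : ℝ => 2 * y + 2 * y ^ 3 / 3) (2 + 2 * y ^ 2) y :=
      (((hasDerivAt_id y).const_mul 2).add
        ((((hasDerivAt_id y).pow 3).const_mul 2).div_const 3)).congr_deriv (by simp; ring)
    exact (h₁.exp.mul h₂.cosh).neg.congr_deriv (by ring)
  have h := apply_zero_le_of_hasDerivAt_nonneg hw hd fun y hy hyw =>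
    mul_nonneg (by positivity) (sub_nonneg.2 (key y hy hyw))
  simp only [ne_eq, OfNat.ofNat_ne_zero, not_false_eq_true, zero_pow, mul_zero, neg_zero, exp_zero,
    zero_div, add_zero, cosh_zero, mul_one, neg_le_neg_iff] at h
  rw [exp_neg, inv_mul_le_iff₀ (exp_pos _)] at h
  linarith

lemma cosh_add_le_exp {v : ℝ} (hv : 0.74 ≤ v) : cosh (v + 0.63) ≤ exp v := by
  have h₁ : exp (0.63 : ℝ) ≤ 1.8777 :=
    (exp_bound' (n := 8) (by norm_num) (by norm_num) (by norm_num)).trans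
      (by norm_num [Finset.sum_range_succ, Nat.factorial])
  have h₂ : exp (-(2 * v + 0.63)) ≤ 0.1222 := by
    have h : (1 / 0.1222 : ℝ) ≤ exp 2.11 :=
      le_trans (by norm_num [Finset.sum_range_succ, Nat.factorial])
        (sum_le_exp_of_nonneg (by norm_num : (0 : ℝ) ≤ 2.11) 12)
    have h' : exp (2.11 : ℝ) ≤ exp (2 * v + 0.63) := exp_le_exp.2 (by linarith)
    rw [exp_neg, inv_le_comm₀ (exp_pos _) (by norm_num)]
    simpa using h.trans h'
  have h₃ : exp (v + 0.63) = exp v * exp 0.63 := exp_add _ _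
  have h₄ : exp (-(v + 0.63)) = exp v * exp (-(2 * v + 0.63)) := by
    rw [← exp_add]; congr 1; ring
  rw [cosh_eq, h₃, h₄]
  nlinarith [exp_pos v]

lemma log_le_div_add {c x : ℝ} (hc : 0 < c) (hx : 0 < x) : log x ≤ x / c - 1 + log c := by
  have h := log_le_sub_one_of_pos (div_pos hx hc)
  rw [log_div hx.ne' hc.ne'] at h
  linarith

lemma log_sinh_bound_of_sq_le {w x : ℝ} (hw : 0 < w) (hx : 0 < x) (hw2 : w ^ 2 ≤ 0.37) :
    1 - 2 * log w + log x + (log (sinh x) + x * cosh x / sinh x) ≤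
      x / w ^ 2 * (2 * w + 2 * w ^ 3 / 3) := by
  obtain ⟨t, rfl⟩ : ∃ t, x = t * w := ⟨x / w, by field_simp⟩
  have ht : 0 < t := pos_of_mul_pos_left hx hw.le
  have hw1 : w ≤ 0.6083 := by nlinarith
  have hrhs : t * w / w ^ 2 * (2 * w + 2 * w ^ 3 / 3) = 2 * t + 2 / 3 * t * w ^ 2 := by
    field_simp
  rw [hrhs]
  have hlog : log (t * w) = log t + log w := log_mul ht.ne' hw.ne'
  have hloge : log t ≤ 0.368 * t := by
    have h := log_le_div_add (exp_pos 1) ht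
    rw [log_exp] at h
    have h' : t / exp 1 ≤ 0.368 * t := by
      rw [div_le_iff₀ (exp_pos 1)]
      nlinarith [exp_one_gt_d9]
    linarith
  have hsq := log_sinh_add_le_sq hx
  have hpos : 0 ≤ t * w ^ 2 := by positivity
  rcases le_or_gt 2 (t * w) with h2 | h2
  · have hlin := log_sinh_add_le_linear hx
    have hlog2 : log 2 ≤ log (t * w) := log_le_log (by norm_num) h2
    have hlog63 : log 0.63 ≤ -0.37 := by
      have := log_le_sub_one_of_pos (by norm_num : (0 : ℝ) < 0.63)
      linarith
    have := log_two_gt_d9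
    nlinarith
  rcases le_or_gt t (4 / 3) with ht1 | ht1
  · have := log_le_sub_one_of_pos ht
    nlinarith [mul_nonneg hpos (sub_nonneg.2 ht1)]
  rcases le_or_gt t 4 with ht4 | ht4
  · have h85 : log (8 / 5) ≤ 0.4705 := by
      rw [log_le_iff_le_exp (by norm_num)]
      exact le_trans (by norm_num [Finset.sum_range_succ, Nat.factorial])
        (sum_le_exp_of_nonneg (by norm_num : (0 : ℝ) ≤ 0.4705) 7)
    have h := log_le_div_add (by norm_num : (0 : ℝ) < 8 / 5) ht
    have hmul : w ^ 2 * (t * (t / 2 - 2 / 3)) ≤ 0.37 * (t * (t / 2 - 2 / 3)) :=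
      mul_le_mul_of_nonneg_right hw2 (mul_nonneg ht.le (by linarith))
    have hquad : 0.37 * (t * (t / 2 - 2 / 3)) ≤ 0.75 * t - 0.941 := by
      nlinarith [mul_nonneg (sub_nonneg.2 ht1.le) (sub_nonneg.2 ht4)]
    have hlogt : 2 * log t ≤ 1.25 * t - 1.059 := by linarith
    linarith
  · nlinarith

/-- The inequality at `r = e`, in the coordinates `e * a = exp (L + x)`, `e * b = exp (L - x)`. -/
lemma cosh_le_exp_of_le_one {L x : ℝ} (hL : L ≤ 1) (hx : 0 ≤ x) :
    cosh (exp L * ((1 - L) * sinh x + x * cosh x)) ≤ exp (2 * exp L * x * sinh x) := by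
  rcases hx.eq_or_lt with rfl | hx
  · simp
  have hS : 0 < sinh x := sinh_pos_iff.2 hx
  have hρ := exp_pos L
  set u := exp L * ((1 - L) * sinh x + x * cosh x) with hu
  set v := 2 * exp L * x * sinh x with hv
  have hu0 : 0 ≤ u := by
    have := cosh_pos x
    have : 0 ≤ 1 - L := by linarith
    positivity
  have hv0 : 0 < v := by positivity
  have hmono : ∀ U, u ≤ U → cosh u ≤ cosh U := fun U hU =>
    cosh_le_cosh.2 (by rwa [abs_of_nonneg hu0, abs_of_nonneg (hu0.trans hU)])
  rcases le_total 0.74 v with h | h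
  · refine (hmono _ ?_).trans (cosh_add_le_exp h)
    set P := exp L * sinh x with hP
    have hP0 : 0 < P := by positivity
    have hlogP : log P = L + log (sinh x) := by
      rw [hP, log_mul hρ.ne' hS.ne', log_exp]
    have hlin := log_sinh_add_le_linear hx
    have htan := log_le_div_add hP0 (by norm_num : (0 : ℝ) < 0.63)
    have huP : u = P * (1 - L + x * cosh x / sinh x) := by
      rw [hu, hP]; field_simp
    have hvP : v = P * (2 * x) := by rw [hv, hP]; ring
    have hdiv : P * (0.63 / P) = 0.63 := by field_simp
    rw [huP, hvP, ← hdiv, ← mul_add]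
    exact mul_le_mul_of_nonneg_left (by linarith) hP0.le
  · set w := √(v / 2) with hw
    have hw0 : 0 < w := sqrt_pos.2 (by positivity)
    have hw2 : w ^ 2 = v / 2 := sq_sqrt (by positivity)
    have hw37 : w ^ 2 ≤ 0.37 := by rw [hw2]; linarith
    have hvw : v = 2 * w ^ 2 := by rw [hw2]; ring
    rw [hvw]
    refine (hmono _ ?_).trans (cosh_two_mul_add_le_exp hw0.le (by nlinarith))
    have hwx : w ^ 2 = exp L * x * sinh x := by rw [hw2, hv]; ring
    have hlog : 2 * log w = L + log x + log (sinh x) := by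
      have := congrArg log hwx
      rwa [log_pow, log_mul (by positivity) hS.ne', log_mul hρ.ne' hx.ne', log_exp] at this
    have hb := log_sinh_bound_of_sq_le hw0 hx hw37
    have huw : u = w ^ 2 / x * (1 - L + x * cosh x / sinh x) := by
      rw [hu, hwx]; field_simp
    have hU : 2 * w + 2 * w ^ 3 / 3 =
        w ^ 2 / x * (x / w ^ 2 * (2 * w + 2 * w ^ 3 / 3)) := by
      field_simp
    rw [huw, hU]
    exact mul_le_mul_of_nonneg_left (by linarith) (by positivity)

lemma exp_mul_add_exp_mul_le_two {A B θ : ℝ} (h0 : 0 ≤ θ) (h1 : θ ≤ 1)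
    (h : exp A + exp B ≤ 2) : exp (θ * A) + exp (θ * B) ≤ 2 := by
  have key : ∀ C, exp (θ * C) ≤ (1 - θ) + θ * exp C := fun C => by
    simpa using convexOn_exp.2 (Set.mem_univ 0) (Set.mem_univ C) (sub_nonneg.2 h1) h0
      (sub_add_cancel 1 θ)
  nlinarith [key A, key B]

/-- The inequality at `r = e` in logarithmic coordinates `x = log a`, `y = log b`. -/
lemma exp_add_exp_le_two_of_le {x y : ℝ} (hx : x ≤ 0) (hyx : y ≤ x) :
    exp (exp 1 * (exp y * x - (exp x * x + exp y * y) / 2)) +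
      exp (exp 1 * (exp x * y - (exp x * x + exp y * y) / 2)) ≤ 2 := by
  have h := cosh_le_exp_of_le_one (L := 1 + (x + y) / 2) (x := (x - y) / 2)
    (by linarith) (by linarith)
  have hmul₁ : exp (1 + (x + y) / 2) * exp ((x - y) / 2) = exp 1 * exp x := by
    rw [← exp_add, ← exp_add]; congr 1; ring
  have hmul₂ : exp (1 + (x + y) / 2) * exp (-((x - y) / 2)) = exp 1 * exp y := by
    rw [← exp_add, ← exp_add]; congr 1; ring
  set ρ := exp (1 + (x + y) / 2)
  have hu : ρ * ((1 - (1 + (x + y) / 2)) * sinh ((x - y) / 2) +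
      (x - y) / 2 * cosh ((x - y) / 2)) = exp 1 * (exp y * x - exp x * y) / 2 := by
    rw [sinh_eq, cosh_eq]
    linear_combination (-y / 2) * hmul₁ + (x / 2) * hmul₂
  have hv : 2 * ρ * ((x - y) / 2) * sinh ((x - y) / 2) =
      exp 1 * ((exp x - exp y) * (x - y)) / 2 := by
    rw [sinh_eq]
    linear_combination ((x - y) / 2) * hmul₁ - ((x - y) / 2) * hmul₂
  rw [hu, hv, cosh_eq] at h
  set u := exp 1 * (exp y * x - exp x * y) / 2 with hu_def
  set v := exp 1 * ((exp x - exp y) * (x - y)) / 2 with hv_def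
  have hA : exp 1 * (exp y * x - (exp x * x + exp y * y) / 2) = -v + u := by
    rw [hu_def, hv_def]; ring
  have hB : exp 1 * (exp x * y - (exp x * x + exp y * y) / 2) = -v + -u := by
    rw [hu_def, hv_def]; ring
  rw [hA, hB, exp_add, exp_add, ← mul_add, exp_neg v, inv_mul_le_iff₀ (exp_pos v)]
  linarith

theorem cirtoaje_conjecture_2_1 (a b r : ℝ) (ha0 : 0 < a) (ha1 : a ≤ 1)
    (hb0 : 0 < b) (hb1 : b ≤ 1) (hr0 : 0 ≤ r) (hre : r ≤ Real.exp 1) :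
    2 * Real.sqrt (a ^ (r * a) * b ^ (r * b)) ≥ a ^ (r * b) + b ^ (r * a) := by
  wlog hba : b ≤ a generalizing a b
  · have h := this b a hb0 hb1 ha0 ha1 (le_of_not_ge hba)
    rwa [mul_comm (b ^ (r * b)), add_comm (b ^ (r * a))] at h
  obtain ⟨x, rfl⟩ : ∃ x, a = exp x := ⟨log a, (exp_log ha0).symm⟩
  obtain ⟨y, rfl⟩ : ∃ y, b = exp y := ⟨log b, (exp_log hb0).symm⟩
  have h := exp_mul_add_exp_mul_le_two (div_nonneg hr0 (exp_pos 1).le)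
    ((div_le_one (exp_pos 1)).2 hre)
    (exp_add_exp_le_two_of_le (exp_le_one_iff.1 ha1) (exp_le_exp.1 hba))
  rw [← mul_assoc, ← mul_assoc, div_mul_cancel₀ _ (exp_pos 1).ne'] at h
  simp only [← exp_mul, ← exp_add]
  rw [← exp_half]
  set m := (x * (r * exp x) + y * (r * exp y)) / 2 with hm
  have hA : x * (r * exp y) = m + r * (exp y * x - (exp x * x + exp y * y) / 2) := by
    rw [hm]; ring
  have hB : y * (r * exp x) = m + r * (exp x * y - (exp x * x + exp y * y) / 2) := by
    rw [hm]; ring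
  rw [hA, hB, exp_add, exp_add, ← mul_add]
  linarith [mul_le_mul_of_nonneg_left h (exp_pos m).le]
end

section
/- For all real numbers a, b, c with 0 < a ≤ 1, 0 < b ≤ 1, 0 < c ≤ 1, the inequality 3·a^a·b^b·c^c ≥ (a·b·c)^a + (a·b·c)^b + (a·b·c)^c holds. -/
open Real

/-- Convexity of `exp` along the segment from `0` to `u`. -/
lemma exp_mul_le_chord {r u : ℝ} (h0 : 0 ≤ r) (h1 : r ≤ 1) :
    exp (r * u) ≤ 1 + r * (exp u - 1) := by
  have h := convexOn_exp.2 (Set.mem_univ 0) (Set.mem_univ u) (sub_nonneg.2 h1) h0 (by ring)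
  simp only [smul_eq_mul, mul_zero, zero_add, exp_zero] at h
  linarith

lemma nonneg_of_deriv_nonneg {f f' : ℝ → ℝ} (hf : ∀ y, HasDerivAt f (f' y) y)
    (hf' : ∀ y, 0 ≤ y → 0 ≤ f' y) (hf0 : f 0 = 0) {y : ℝ} (hy : 0 ≤ y) : 0 ≤ f y := by
  have hm : MonotoneOn f (Set.Ici 0) :=
    monotoneOn_of_deriv_nonneg (convex_Ici 0)
      (fun z _ => (hf z).continuousAt.continuousWithinAt)
      (fun z _ => (hf z).differentiableAt.differentiableWithinAt)
      (fun z hz => by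
        rw [interior_Ici] at hz
        rw [(hf z).deriv]
        exact hf' z (le_of_lt hz))
  rw [← hf0]
  exact hm Set.self_mem_Ici hy hy

lemma hasDerivAt_exp_neg (y : ℝ) : HasDerivAt (fun z : ℝ => exp (-z)) (-exp (-y)) y := by
  simpa using (hasDerivAt_neg y).exp

lemma two_sub_le_exp_neg_mul {y : ℝ} (hy : 0 ≤ y) : 2 - y ≤ exp (-y) * (2 + y) := by
  have h := nonneg_of_deriv_nonneg (f := fun z => exp (-z) * (2 + z) + (z - 2))
    (f' := fun z => -exp (-z) * (2 + z) + exp (-z) * 1 + 1)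
    (fun z => ((hasDerivAt_exp_neg z).mul ((hasDerivAt_id z).const_add 2)).add
      ((hasDerivAt_id z).sub_const 2))
    (fun z hz => by
      have h1 : exp (-z) * (1 + z) ≤ 1 := by
        calc exp (-z) * (1 + z) ≤ exp (-z) * exp z := by
              gcongr; linarith [add_one_le_exp z]
          _ = 1 := by rw [← exp_add]; simp
      linarith)
    (by simp) hy
  linarith

lemma exp_neg_mul_le_pade {y : ℝ} (hy : 0 ≤ y) : exp (-y) * (6 + 2 * y) ≤ 6 - 4 * y + y ^ 2 := by
  have h := nonneg_of_deriv_nonneg (f := fun z => (z * z - 4 * z) + 6 - exp (-z) * (6 + 2 * z))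
    (f' := fun z => (1 * z + z * 1 - 4 * 1) -
      (-exp (-z) * (6 + 2 * z) + exp (-z) * (2 * 1)))
    (fun z => ((((hasDerivAt_id z).mul (hasDerivAt_id z)).sub
      ((hasDerivAt_id z).const_mul 4)).add_const 6).sub
      ((hasDerivAt_exp_neg z).mul (((hasDerivAt_id z).const_mul 2).const_add 6)))
    (fun z hz => by
      have := two_sub_le_exp_neg_mul hz
      linarith)
    (by simp) hy
  linarith

lemma three_mul_sinh_le {w : ℝ} (hw : 0 ≤ w) : 3 * sinh w ≤ w * (2 + cosh w) := by
  have h := nonneg_of_deriv_nonneg (f := fun z => z * (2 + cosh z) - 3 * sinh z)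
    (f' := fun z => 1 * (2 + cosh z) + z * sinh z - 3 * cosh z)
    (fun z => ((hasDerivAt_id z).mul ((hasDerivAt_cosh z).const_add 2)).sub
      ((hasDerivAt_sinh z).const_mul 3))
    (fun z hz => by
      have h1 := two_sub_le_exp_neg_mul hz
      have h2 : exp (-z) * exp z = 1 := by rw [← exp_add]; simp
      have h3 : exp (-z) ≤ 1 := exp_le_one_iff.2 (by linarith)
      have h4 : 1 ≤ exp z := one_le_exp hz
      rw [cosh_eq, sinh_eq]
      have h5 : 0 ≤ (exp z - 1) * (exp (-z) * (2 + z) - (2 - z)) :=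
        mul_nonneg (by linarith) (by linarith)
      have h6 : 0 ≤ (exp z - 1) * (1 - exp (-z)) := mul_nonneg (by linarith) (by linarith)
      nlinarith)
    (by simp) hw
  linarith

/-- Simpson's rule overestimates the integral of `exp (-t)` over `[x, m]`. -/
lemma exp_neg_sub_le_simpson {x m : ℝ} (h : x ≤ m) :
    6 * (exp (-x) - exp (-m)) ≤
      (m - x) * (exp (-x) + 4 * exp (-((x + m) / 2)) + exp (-m)) := by
  have h1 := three_mul_sinh_le (w := (m - x) / 2) (by linarith)
  rw [sinh_eq, cosh_eq] at h1
  have h2 := mul_le_mul_of_nonneg_right h1 (exp_pos (-((x + m) / 2))).le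
  have e1 : exp (-x) = exp ((m - x) / 2) * exp (-((x + m) / 2)) := by
    rw [← exp_add]; ring_nf
  have e2 : exp (-m) = exp (-((m - x) / 2)) * exp (-((x + m) / 2)) := by
    rw [← exp_add]; ring_nf
  rw [e1, e2]
  linarith

lemma exp_neg_one_lt : exp (-1) < 0.36788 := by
  rw [exp_neg, inv_lt_comm₀ (exp_pos 1) (by norm_num)]
  linarith [exp_one_gt_d9]

lemma exp_neg_two_mem : 0.1353 < exp (-2) ∧ exp (-2) < 0.13534 := by
  have e : exp (-2) = (exp 1 ^ 2)⁻¹ := by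
    rw [exp_neg, ← exp_nat_mul]; norm_num
  have h1 := exp_one_gt_d9
  have h2 := exp_one_lt_d9
  rw [e]
  constructor
  · rw [lt_inv_comm₀ (by norm_num) (by positivity)]
    nlinarith
  · rw [inv_lt_comm₀ (by positivity) (by norm_num)]
    nlinarith

lemma mul_exp_neg_le (x : ℝ) : x * exp (-x) ≤ exp (-1) := by
  calc x * exp (-x) ≤ exp (x - 1) * exp (-x) := by
        gcongr; linarith [add_one_le_exp (x - 1)]
    _ = exp (-1) := by rw [← exp_add]; ring_nf

lemma sq_mul_exp_neg_le {x : ℝ} (hx : 0 ≤ x) : x ^ 2 * exp (-x) ≤ 0.54136 := by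
  have h := mul_exp_neg_le (x / 2)
  have h0 : 0 ≤ x / 2 * exp (-(x / 2)) := by positivity
  have e1 : exp (-x) = exp (-(x / 2)) ^ 2 := by rw [← exp_nat_mul]; ring_nf
  have e2 : exp (-2) = exp (-1) ^ 2 := by rw [← exp_nat_mul]; norm_num
  have h2 := exp_neg_two_mem.2
  rw [e1]
  have := pow_le_pow_left₀ h0 h 2
  nlinarith

/-- The tangent-line inequality, to the right of the point of tangency. -/
lemma tangent_of_le {m x : ℝ} (hm : 0 < m) (hx : m ≤ x) :
    exp (3 * m * (exp (-m) - exp (-x))) ≤ 1 + 3 * x * (exp (-m) - exp (-x)) := by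
  set g := exp (-m) with hg
  have ea : exp (-x) = g * exp (-(x - m)) := by rw [hg, ← exp_add]; ring_nf
  obtain ⟨s, hs⟩ : ∃ s, s = 1 - exp (-(x - m)) := ⟨_, rfl⟩
  have hs0 : 0 ≤ s := by
    rw [hs, sub_nonneg]; exact exp_le_one_iff.2 (by linarith)
  have hs1 : s < 1 := by rw [hs]; linarith [exp_pos (-(x - m))]
  have hgp : 0 < g := exp_pos _
  have h1 : 3 * m * g ≤ 1.1037 := by linarith [mul_exp_neg_le m, exp_neg_one_lt]
  have h2 : m ^ 2 * g ≤ 0.54136 := sq_mul_exp_neg_le hm.le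
  have hd := two_sub_le_exp_neg_mul (y := x - m) (by linarith)
  have hd' : 2 * s ≤ (x - m) * (2 - s) := by
    have : exp (-(x - m)) = 1 - s := by rw [hs]; ring
    rw [this] at hd; nlinarith
  have eh : g - exp (-x) = g * s := by rw [ea, hs]; ring
  rw [eh]
  obtain ⟨y, hy⟩ : ∃ y, y = 3 * m * (g * s) := ⟨_, rfl⟩
  have hy0 : 0 ≤ y := by rw [hy]; positivity
  have hy1 : y ≤ 1.1037 := by
    rw [hy]; nlinarith [mul_pos hm hgp]
  have hE := two_sub_le_exp_neg_mul hy0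
  have hE2 : exp y * (2 - y) ≤ 2 + y := by
    have : exp (-y) * exp y = 1 := by rw [← exp_add]; simp
    nlinarith [exp_pos y]
  rw [← hy]
  have key : 2 * y ≤ (3 * x * (g * s)) * (2 - y) := by
    have h3 : m * y ≤ (x - m) * (2 - y) := by
      have h4 : m * y * (2 - s) ≤ 2 * s * (2 - y) := by
        have h5 : 3 * (m ^ 2 * g) * (2 - s) ≤ 2 * (2 - 3 * m * g * s) := by nlinarith
        have := mul_le_mul_of_nonneg_left h5 hs0
        rw [hy]; nlinarith
      have h6 : 2 * s * (2 - y) ≤ (x - m) * (2 - s) * (2 - y) :=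
        mul_le_mul_of_nonneg_right hd' (by linarith)
      have h7 : (m * y) * (2 - s) ≤ ((x - m) * (2 - y)) * (2 - s) := by nlinarith
      exact le_of_mul_le_mul_right h7 (by linarith)
    have h8 := mul_le_mul_of_nonneg_left h3 (mul_nonneg hgp.le hs0)
    rw [show 2 * y = y * (2 - y) + y * y by ring]
    have : y * y = 3 * (g * s * (m * y)) := by rw [hy]; ring
    rw [this]
    have : y * (2 - y) = 3 * m * (g * s) * (2 - y) := by rw [← hy]
    rw [this]
    nlinarith
  have : exp y * (2 - y) ≤ (1 + 3 * x * (g * s)) * (2 - y) := by nlinarith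
  exact le_of_mul_le_mul_right this (by linarith)

/-- The tangent-line inequality, moderately far to the left of the point of tangency. -/
lemma tangent_of_ge_of_le {m x : ℝ} (hm : 0 < m) (hx : x ≤ m) (hx' : 3 / 5 * m ≤ x) :
    exp (3 * m * (exp (-m) - exp (-x))) ≤ 1 + 3 * x * (exp (-m) - exp (-x)) := by
  have hsim := exp_neg_sub_le_simpson hx
  obtain ⟨u, hu⟩ : ∃ u, u = (x + m) / 2 := ⟨_, rfl⟩
  obtain ⟨w, hw⟩ : ∃ w, w = (m - x) / 2 := ⟨_, rfl⟩
  have hx0 : 0 < x := by linarith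
  have hcosh : exp (-x) + exp (-m) ≤ exp (-(3 / 4 * u)) + exp (-(5 / 4 * u)) := by
    have h1 : cosh w ≤ cosh (u / 4) := by
      rw [cosh_le_cosh, abs_of_nonneg (by linarith), abs_of_nonneg (by linarith)]
      linarith
    rw [cosh_eq, cosh_eq] at h1
    have h2 := mul_le_mul_of_nonneg_right h1 (exp_pos (-u)).le
    have e1 : exp (-x) = exp w * exp (-u) := by rw [← exp_add, hu, hw]; ring_nf
    have e2 : exp (-m) = exp (-w) * exp (-u) := by rw [← exp_add, hu, hw]; ring_nf
    have e3 : exp (-(3 / 4 * u)) = exp (u / 4) * exp (-u) := by rw [← exp_add]; ring_nf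
    have e4 : exp (-(5 / 4 * u)) = exp (-(u / 4)) * exp (-u) := by rw [← exp_add]; ring_nf
    rw [e1, e2, e3, e4]; linarith
  have hu0 : 0 ≤ u := by linarith
  have q1 := sq_mul_exp_neg_le (x := 3 / 4 * u) (by linarith)
  have q2 := sq_mul_exp_neg_le (x := 5 / 4 * u) (by linarith)
  have q3 := sq_mul_exp_neg_le hu0
  have hpoly : m * (m + 2 * x) ≤ 55 / 16 * u ^ 2 := by
    rw [hu]; nlinarith
  have hS : m * (m + 2 * x) * (exp (-x) + 4 * exp (-u) + exp (-m)) ≤ 12 := by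
    calc m * (m + 2 * x) * (exp (-x) + 4 * exp (-u) + exp (-m))
        ≤ 55 / 16 * u ^ 2 * (exp (-(3 / 4 * u)) + exp (-(5 / 4 * u)) + 4 * exp (-u)) := by
          apply mul_le_mul hpoly (by linarith) (by positivity) (by positivity)
      _ ≤ 12 := by nlinarith
  rw [← hu] at hsim
  obtain ⟨h, hh⟩ : ∃ h, h = exp (-x) - exp (-m) := ⟨_, rfl⟩
  have hh0 : 0 ≤ h := by rw [hh, sub_nonneg]; exact exp_le_exp.2 (by linarith)
  have hA : m * (m + 2 * x) * h ≤ 2 * (m - x) := by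
    have h1 := mul_le_mul_of_nonneg_left hsim (by positivity : 0 ≤ m * (m + 2 * x))
    have h2 := mul_le_mul_of_nonneg_left hS (sub_nonneg.2 hx)
    rw [← hh] at h1
    nlinarith
  have hp := exp_neg_mul_le_pade (y := 3 * m * h) (by positivity)
  have e : exp (-m) - exp (-x) = -h := by rw [hh]; ring
  rw [e, show 3 * m * -h = -(3 * m * h) by ring]
  have hpos : 0 < 6 + 2 * (3 * m * h) := by positivity
  refine le_of_mul_le_mul_right (hp.trans ?_) hpos
  nlinarith [mul_le_mul_of_nonneg_left hA hh0]

/-- If `1 - t₀ ≥ exp (-t₀ / s₀)`, the same inequality holds for smaller `t` and `s`. -/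
lemma exp_neg_div_le_one_sub {s s₀ t t₀ : ℝ} (hs : 0 < s) (hss : s ≤ s₀) (ht : 0 ≤ t)
    (htt : t ≤ t₀) (ht₀ : 0 < t₀) (h : exp (-(t₀ / s₀)) ≤ 1 - t₀) : exp (-(t / s)) ≤ 1 - t := by
  have h1 : exp (-(t / s)) ≤ exp (t / t₀ * -(t₀ / s₀)) := by
    apply exp_le_exp.2
    have : t / t₀ * -(t₀ / s₀) = -(t / s₀) := by field_simp
    rw [this, neg_le_neg_iff]
    gcongr
  have h2 := exp_mul_le_chord (r := t / t₀) (u := -(t₀ / s₀)) (by positivity)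
    ((div_le_one ht₀).2 htt)
  have h3 : t / t₀ * (exp (-(t₀ / s₀)) - 1) ≤ t / t₀ * (-t₀) := by
    gcongr; linarith
  have h4 : t / t₀ * (-t₀) = -t := by field_simp
  linarith

lemma tangent_of_mul_le {m x : ℝ} (hm : 0 < m) (hx : 0 ≤ x) (hx' : x ≤ 3 / 5 * m)
    (h : 3 * x * (exp (-x) - exp (-m)) ≤ 0.6) :
    exp (3 * m * (exp (-m) - exp (-x))) ≤ 1 + 3 * x * (exp (-m) - exp (-x)) := by
  have hg : exp (-m) ≤ exp (-x) := exp_le_exp.2 (by linarith)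
  rcases hx.eq_or_lt with rfl | hx0
  · simp only [mul_zero, zero_mul, add_zero]
    exact exp_le_one_iff.2 (mul_nonpos_of_nonneg_of_nonpos (by positivity) (by linarith))
  have h1 := exp_neg_div_le_one_sub (s := x / m) (s₀ := 3 / 5) (t₀ := 0.6) (by positivity)
    (by rw [div_le_iff₀ hm]; exact hx') (by have := sub_nonneg.2 hg; positivity) h (by norm_num)
    (by norm_num; linarith [exp_neg_one_lt])
  have e : -(3 * x * (exp (-x) - exp (-m)) / (x / m)) = 3 * m * (exp (-m) - exp (-x)) := by
    field_simp; ring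
  rw [e] at h1
  linarith

lemma exp_neg_le_of_pow {p q : ℕ} {r z : ℝ} (hq : q ≠ 0) (hr : 0 ≤ r) (hz : (p : ℝ) ≤ q * z)
    (h : (0.36788 : ℝ) ^ p ≤ r ^ q) : exp (-z) ≤ r := by
  refine le_of_pow_le_pow_left₀ hq hr ?_
  calc exp (-z) ^ q = exp (q * -z) := (exp_nat_mul _ _).symm
    _ ≤ exp (p * -1) := exp_le_exp.2 (by linarith)
    _ = exp (-1) ^ p := exp_nat_mul _ _
    _ ≤ 0.36788 ^ p := pow_le_pow_left₀ (exp_pos _).le exp_neg_one_lt.le p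
    _ ≤ r ^ q := h

lemma cube_mul_exp_neg_le_one {d : ℝ} (hd : -3 ≤ d) : (1 + d / 3) ^ 3 * exp (-d) ≤ 1 := by
  have h1 : 1 + d / 3 ≤ exp (d / 3) := by linarith [add_one_le_exp (d / 3)]
  calc (1 + d / 3) ^ 3 * exp (-d) ≤ exp (d / 3) ^ 3 * exp (-d) := by
        gcongr; linarith
    _ = 1 := by rw [← exp_nat_mul, ← exp_add]; push_cast; ring_nf; exact exp_zero

/-- An upper bound for `Q * exp (-x)` from a cubic lower bound for `exp` at `x₀`. -/
lemma quadratic_mul_exp_neg_le {x x₀ E K Q : ℝ} (hx : 0 ≤ x) (hx₀ : x₀ ≤ 3) (hK : 0 ≤ K)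
    (hQ : 0 ≤ Q) (hE : exp (-x₀) ≤ E) (h : Q * E ≤ K * (1 + (x - x₀) / 3) ^ 3) :
    Q * exp (-x) ≤ K := by
  have h1 := cube_mul_exp_neg_le_one (d := x - x₀) (by linarith)
  calc Q * exp (-x) = Q * exp (-x₀) * exp (-(x - x₀)) := by
        rw [mul_assoc, ← exp_add]; ring_nf
    _ ≤ K * (1 + (x - x₀) / 3) ^ 3 * exp (-(x - x₀)) :=
        mul_le_mul_of_nonneg_right ((mul_le_mul_of_nonneg_left hE hQ).trans h) (exp_pos _).le
    _ ≤ K := by nlinarith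

lemma gap_bound_of_ratio {x : ℝ} (hx : 0 ≤ x) :
    x * exp (-x) * (1 - 3 * exp (-2) + exp (-2) * (2 / 3 * x)) ≤ 0.26 ∧
    x * exp (-x) * (1 - 3 * exp (-2) + exp (-2) * x) ≤ 0.275 ∧
    x * exp (-x) * (1 - 3 * exp (-2) + exp (-2) * (7 / 3 * x)) ≤ 0.36 := by
  obtain ⟨h1, h2⟩ := exp_neg_two_mem
  have hx2 := sq_nonneg x
  have hE : exp (-(6 / 5)) ≤ 1 / 3.32 :=
    exp_neg_le_of_pow (p := 6) (q := 5) (by norm_num) (by norm_num) (by norm_num) (by norm_num)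
  have hE' : exp (-(7 / 5)) ≤ 1 / 4.055 :=
    exp_neg_le_of_pow (p := 7) (q := 5) (by norm_num) (by norm_num) (by norm_num) (by norm_num)
  have key : ∀ β : ℝ, 0 ≤ β →
      x * exp (-x) * (1 - 3 * exp (-2) + exp (-2) * (β * x)) ≤
        (0.5941 * x + 0.13534 * β * x ^ 2) * exp (-x) := by
    intro β hβ
    have : x * (1 - 3 * exp (-2) + exp (-2) * (β * x)) ≤ 0.5941 * x + 0.13534 * β * x ^ 2 := by
      nlinarith [mul_nonneg hβ hx2]
    nlinarith [exp_pos (-x)]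
  refine ⟨(key (2 / 3) (by norm_num)).trans ?_, ?_, (key (7 / 3) (by norm_num)).trans ?_⟩
  · refine quadratic_mul_exp_neg_le hx (by norm_num) (by norm_num) (by positivity) hE ?_
    nlinarith [mul_nonneg hx (sq_nonneg (x - 1.1)), sq_nonneg (x - 1.1)]
  · have := key 1 (by norm_num)
    rw [one_mul] at this
    refine this.trans ?_
    refine quadratic_mul_exp_neg_le hx (by norm_num) (by norm_num) (by positivity) hE ?_
    nlinarith [mul_nonneg hx (sq_nonneg (x - 1.2)), sq_nonneg (x - 1.2)]
  · refine quadratic_mul_exp_neg_le hx (by norm_num) (by norm_num) (by positivity) hE' ?_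
    nlinarith [mul_nonneg hx (sq_nonneg (x - 1.45)), sq_nonneg (x - 1.45)]

lemma mul_exp_neg_sub_le {x n : ℝ} (hx : 0 ≤ x) :
    x * (exp (-x) - exp (-n)) ≤ x * exp (-x) * (1 - 3 * exp (-2) + exp (-2) * (n - x)) := by
  have h1 : exp (-n) = exp (-x) * (exp (-2) * exp (-(n - x - 2))) := by
    rw [← exp_add, ← exp_add]; ring_nf
  have h2 := add_one_le_exp (-(n - x - 2))
  have h3 : exp (-2) * (3 - (n - x)) ≤ exp (-2) * exp (-(n - x - 2)) := by
    gcongr; linarith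
  have h4 := mul_le_mul_of_nonneg_left h3 (mul_nonneg hx (exp_pos (-x)).le)
  rw [h1]
  linarith

lemma exp_neg_div_line_le {s : ℝ} (h1 : 3 / 10 ≤ s) (h2 : s ≤ 3 / 5) :
    exp (-((1.19 - 0.9 * s) / s)) ≤ 1 - (1.19 - 0.9 * s) := by
  have hs : 0 < s := by linarith
  obtain ⟨δ, hδ⟩ : ∃ δ, δ = 1.19 / s - 1.19 / 0.6 := ⟨_, rfl⟩
  have hδs : δ * s = 119 / 60 * (3 / 5 - s) := by rw [hδ]; field_simp; ring
  have hδ0 : 0 ≤ δ := by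
    by_contra! h
    nlinarith
  have hE : exp (-(13 / 12)) ≤ 0.3386 :=
    exp_neg_le_of_pow (p := 13) (q := 12) (by norm_num) (by norm_num) (by norm_num) (by norm_num)
  have e : exp (-((1.19 - 0.9 * s) / s)) * exp δ = exp (-(13 / 12)) := by
    rw [← exp_add, hδ]; congr 1; field_simp; ring
  have hq := quadratic_le_exp_of_nonneg hδ0
  have hpos : 0 < 1 + δ + δ ^ 2 / 2 := by positivity
  refine le_of_mul_le_mul_right (a := 1 + δ + δ ^ 2 / 2) ?_ hpos
  calc exp (-((1.19 - 0.9 * s) / s)) * (1 + δ + δ ^ 2 / 2)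
      ≤ exp (-((1.19 - 0.9 * s) / s)) * exp δ := by gcongr
    _ ≤ 0.3386 := by rw [e]; exact hE
    _ ≤ (1 - (1.19 - 0.9 * s)) * (1 + δ + δ ^ 2 / 2) := by
        refine le_of_mul_le_mul_right (a := s ^ 2) ?_ (by positivity)
        have e2 : (1 - (1.19 - 0.9 * s)) * (1 + δ + δ ^ 2 / 2) * s ^ 2 =
            (0.9 * s - 0.19) * (s ^ 2 + (δ * s) * s + (δ * s) ^ 2 / 2) := by ring
        rw [e2, hδs]
        nlinarith [mul_nonneg (sub_nonneg.2 h1) (sub_nonneg.2 h2),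
          mul_nonneg (mul_nonneg (sub_nonneg.2 h1) (sub_nonneg.2 h2)) (sub_nonneg.2 h1),
          mul_nonneg (mul_nonneg (sub_nonneg.2 h1) (sub_nonneg.2 h2)) (sub_nonneg.2 h2)]

/-- The tangent-line inequality with a smaller constant, far to the left. -/
lemma tangent_far_left {n y : ℝ} (hn : 0 < n) (hy : 0 ≤ y) (hyn : y ≤ 3 / 5 * n) :
    exp (5 / 2 * n * (exp (-n) - exp (-y))) ≤ 1 + 5 / 2 * y * (exp (-n) - exp (-y)) := by
  have hg : exp (-n) ≤ exp (-y) := exp_le_exp.2 (by linarith)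
  rcases hy.eq_or_lt with rfl | hy0
  · simp only [mul_zero, zero_mul, add_zero]
    exact exp_le_one_iff.2 (mul_nonpos_of_nonneg_of_nonpos (by positivity) (by linarith))
  obtain ⟨s, hs⟩ : ∃ s, s = y / n := ⟨_, rfl⟩
  have hs0 : 0 < s := by rw [hs]; positivity
  have hs1 : s ≤ 3 / 5 := by rw [hs, div_le_iff₀ hn]; exact hyn
  have hsn : s * n = y := by rw [hs]; field_simp
  obtain ⟨t, ht⟩ : ∃ t, t = 5 / 2 * y * (exp (-y) - exp (-n)) := ⟨_, rfl⟩
  have ht0 : 0 ≤ t := by have := sub_nonneg.2 hg; rw [ht]; positivity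
  have main : exp (-(t / s)) ≤ 1 - t := by
    rcases le_total s (3 / 10) with h3 | h3
    · refine exp_neg_div_le_one_sub hs0 h3 ht0 (t₀ := 0.92) ?_ (by norm_num) ?_
      · rw [ht]
        nlinarith [mul_exp_neg_le y, exp_neg_one_lt, mul_pos hy0 (exp_pos (-n))]
      · exact exp_neg_le_of_pow (p := 3) (q := 1) (by norm_num) (by norm_num) (by norm_num)
          (by norm_num)
    · refine exp_neg_div_le_one_sub hs0 le_rfl ht0 (t₀ := 1.19 - 0.9 * s) ?_ (by linarith)
        (exp_neg_div_line_le h3 hs1)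
      obtain ⟨k1, -, k3⟩ := gap_bound_of_ratio hy
      have hD := mul_exp_neg_sub_le (n := n) hy
      refine le_of_mul_le_mul_left (a := s) ?_ hs0
      have e : s * (y * exp (-y) * (1 - 3 * exp (-2) + exp (-2) * (n - y))) =
          y * exp (-y) * ((1 - 3 * exp (-2)) * s + exp (-2) * y * (1 - s)) := by
        rw [← hsn]; ring
      have hD' := mul_le_mul_of_nonneg_left hD hs0.le
      rw [e] at hD'
      have hlin : y * exp (-y) * ((1 - 3 * exp (-2)) * s + exp (-2) * y * (1 - s)) ≤
          ((s - 3 / 10) * 0.156 + (3 / 5 - s) * 0.108) * (10 / 3) := by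
        have a1 := mul_le_mul_of_nonneg_left k1 (sub_nonneg.2 h3)
        have a3 := mul_le_mul_of_nonneg_left k3 (sub_nonneg.2 hs1)
        linarith
      rw [ht]
      nlinarith [mul_nonneg (sub_nonneg.2 h3) (sub_nonneg.2 hs1)]
  have e : -(t / s) = 5 / 2 * n * (exp (-n) - exp (-y)) := by
    rw [ht, hs]; field_simp; ring
  rw [e] at main
  linarith

lemma exp_le_one_add_mul_of_le {r r₀ u v : ℝ} (hr : 0 ≤ r) (hr₀ : 0 < r₀) (hrr : r ≤ r₀)
    (h : exp (r₀ * u) ≤ 1 + r₀ * v) : exp (r * u) ≤ 1 + r * v := by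
  have h1 := exp_mul_le_chord (r := r / r₀) (u := r₀ * u) (by positivity)
    ((div_le_one hr₀).2 hrr)
  have e : r / r₀ * (r₀ * u) = r * u := by field_simp
  have e2 : r / r₀ * (r₀ * v) = r * v := by field_simp
  rw [e] at h1
  have h2 : r / r₀ * (exp (r₀ * u) - 1) ≤ r / r₀ * (r₀ * v) := by
    gcongr; linarith
  linarith

lemma tangent_of_ratio_le {r n y : ℝ} (hr : 0 ≤ r) (hr' : r ≤ 5 / 2) (hn : 0 < n) (hy : 0 ≤ y) :
    exp (r * (n * (exp (-n) - exp (-y)))) ≤ 1 + r * (y * (exp (-n) - exp (-y))) := by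
  rcases le_total y (3 / 5 * n) with h | h
  · refine exp_le_one_add_mul_of_le hr (by norm_num) hr' ?_
    have := tangent_far_left hn hy h
    rwa [mul_assoc, mul_assoc] at this
  · refine exp_le_one_add_mul_of_le hr (r₀ := 3) (by norm_num) (by linarith) ?_
    rw [← mul_assoc, ← mul_assoc]
    rcases le_total n y with h' | h'
    · exact tangent_of_le hn h'
    · exact tangent_of_ge_of_le hn h' h

lemma add_exp_neg_div_mono {σ p L : ℝ} (hσ : 0 < σ) (hσ1 : σ ≤ 1) (hp : 0.2 ≤ p) (hL : p ≤ L) :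
    p + (1 - σ) / 2 * exp (-(p / σ)) ≤ L + (1 - σ) / 2 * exp (-(L / σ)) := by
  have h1 : exp (-(L / σ)) = exp (-(p / σ)) * exp (-((L - p) / σ)) := by
    rw [← exp_add]; ring_nf
  have h2 := add_one_le_exp (-((L - p) / σ))
  have h3 : exp (-(p / σ)) ≤ exp (-(0.2 / σ)) := by
    apply exp_le_exp.2; rw [neg_le_neg_iff]; gcongr
  have h4 := mul_exp_neg_le (0.2 / σ)
  have h5 : exp (-(p / σ)) ≤ 2 * σ := by
    have h6 : 0.2 / σ * exp (-(p / σ)) ≤ 0.36788 :=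
      (mul_le_mul_of_nonneg_left h3 (by positivity)).trans (h4.trans exp_neg_one_lt.le)
    have h7 : 0.2 * exp (-(p / σ)) ≤ 0.36788 * σ := by
      have := mul_le_mul_of_nonneg_right h6 hσ.le
      have e : 0.2 / σ * exp (-(p / σ)) * σ = 0.2 * exp (-(p / σ)) := by field_simp
      linarith
    linarith
  have h8 : exp (-(p / σ)) - exp (-(L / σ)) ≤ exp (-(p / σ)) * ((L - p) / σ) := by
    rw [h1]; nlinarith [exp_pos (-(p / σ))]
  have h9 : exp (-(p / σ)) * ((L - p) / σ) ≤ 2 * (L - p) := by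
    calc exp (-(p / σ)) * ((L - p) / σ) ≤ 2 * σ * ((L - p) / σ) := by
          gcongr
      _ = 2 * (L - p) := by field_simp
  nlinarith

lemma add_log_one_sub_anti {σ σ₀ : ℝ} (h : σ ≤ σ₀) (h0 : 0 ≤ σ) (h1 : σ₀ < 1) :
    σ₀ + log (3 / 2 * (1 - σ₀)) ≤ σ + log (3 / 2 * (1 - σ)) := by
  have hp : 0 < 1 - σ := by linarith
  have hp' : 0 < 1 - σ₀ := by linarith
  have h2 := one_sub_inv_le_log_of_pos (div_pos hp hp')
  rw [log_div hp.ne' hp'.ne', inv_div] at h2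
  rw [log_mul (by norm_num) hp.ne', log_mul (by norm_num) hp'.ne']
  have h3 : σ₀ - σ ≤ 1 - (1 - σ₀) / (1 - σ) := by
    have : 1 - (1 - σ₀) / (1 - σ) = (σ₀ - σ) / (1 - σ) := by field_simp; ring
    rw [this, le_div_iff₀ hp]
    nlinarith
  linarith

lemma scalar_bound_of_small {σ p : ℝ} (hσ : 0 < σ) (hσ1 : σ ≤ 3 / 23) (hp : 0.2 ≤ p)
    (hp1 : p ≤ exp (-1)) :
    p + (1 - σ) / 2 * exp (-(p / σ)) ≤ σ + log (3 / 2 * (1 - σ)) := by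
  have h0 := add_exp_neg_div_mono hσ (by linarith) hp (hp1.trans exp_neg_one_lt.le)
  rcases le_total σ 0.1 with h | h
  · have h1 := add_log_one_sub_anti h hσ.le (by norm_num)
    have h2 : exp (-(0.36788 / σ)) ≤ 0.05 := by
      refine exp_neg_le_of_pow (p := 3) (q := 1) (by norm_num) (by norm_num) ?_ (by norm_num)
      push_cast
      rw [one_mul, le_div_iff₀ hσ]; linarith
    have h3 := le_log_one_add_of_nonneg (x := 0.35) (by norm_num)
    norm_num at h1 h3
    nlinarith [exp_pos (-(0.36788 / σ))]
  · have h1 := add_log_one_sub_anti hσ1 hσ.le (by norm_num)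
    have h2 : exp (-(0.36788 / σ)) ≤ 0.0609 := by
      refine exp_neg_le_of_pow (p := 14) (q := 5) (by norm_num) (by norm_num) ?_ (by norm_num)
      push_cast
      rw [mul_div_assoc', le_div_iff₀ hσ]; linarith
    have h3 := le_log_one_add_of_nonneg (x := 0.15) (by norm_num)
    have h4 := le_log_one_add_of_nonneg (x := 71 / 529) (by norm_num)
    have e : log (30 / 23) = log (23 / 20) + log (600 / 529) := by
      rw [← log_mul (by norm_num) (by norm_num)]; norm_num
    norm_num at h1 h3 h4
    rw [e] at h1
    nlinarith [exp_pos (-(0.36788 / σ))]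

lemma scalar_bound_of_line {σ p : ℝ} (hσ : 3 / 23 ≤ σ) (hσ1 : σ ≤ 1 / 5) (hp : 0.2 ≤ p)
    (hp1 : p ≤ 0.525 - 1.25 * σ) :
    p + (1 - σ) / 2 * exp (-(p / σ)) ≤ σ + log (3 / 2 * (1 - σ)) := by
  have hσ0 : 0 < σ := by linarith
  have h0 := add_exp_neg_div_mono hσ0 (by linarith) hp hp1
  obtain ⟨τ, hτ⟩ : ∃ τ, τ = 1 / 5 - σ := ⟨_, rfl⟩
  have hτ0 : 0 ≤ τ := by linarith
  have hτ1 : τ ≤ 0.07 := by linarith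
  have hlog : 0.182 + 1.25 * τ - 0.782 * τ ^ 2 ≤ log (3 / 2 * (1 - σ)) := by
    have e : 3 / 2 * (1 - σ) = (1 + 0.1) * (1 + 1 / 11) * (1 + τ / 0.8) := by rw [hτ]; ring
    rw [e, log_mul (by positivity) (by positivity), log_mul (by norm_num) (by norm_num)]
    have h3 := le_log_one_add_of_nonneg (x := 0.1) (by norm_num)
    have h4 := le_log_one_add_of_nonneg (x := 1 / 11) (by norm_num)
    have h5 := le_log_one_add_of_nonneg (x := τ / 0.8) (by positivity)
    have h6 : 1.25 * τ - 0.782 * τ ^ 2 ≤ 2 * (τ / 0.8) / (τ / 0.8 + 2) := by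
      rw [le_div_iff₀ (by positivity)]
      nlinarith [pow_nonneg hτ0 2, pow_nonneg hτ0 3]
    norm_num at h3 h4 h5 h6 ⊢
    linarith
  obtain ⟨δ, hδ⟩ : ∃ δ, δ = 2.625 * τ / σ := ⟨_, rfl⟩
  have hδ0 : 0 ≤ δ := by rw [hδ]; positivity
  have hδs : δ * σ = 2.625 * τ := by rw [hδ]; field_simp
  have hE : exp (-(11 / 8)) ≤ 0.2529 :=
    exp_neg_le_of_pow (p := 11) (q := 8) (by norm_num) (by norm_num) (by norm_num) (by norm_num)
  have e : exp (-((0.525 - 1.25 * σ) / σ)) * exp δ = exp (-(11 / 8)) := by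
    rw [← exp_add, hδ, hτ]; congr 1; field_simp; ring
  have hq := quadratic_le_exp_of_nonneg hδ0
  have hF : (1 - σ) / 2 * exp (-((0.525 - 1.25 * σ) / σ)) ≤ 0.107 - τ - 0.782 * τ ^ 2 := by
    refine le_of_mul_le_mul_right (a := 1 + δ + δ ^ 2 / 2) ?_ (by positivity)
    calc (1 - σ) / 2 * exp (-((0.525 - 1.25 * σ) / σ)) * (1 + δ + δ ^ 2 / 2)
        ≤ (1 - σ) / 2 * exp (-((0.525 - 1.25 * σ) / σ)) * exp δ := by
          gcongr
          exact mul_nonneg (by linarith) (exp_pos _).le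
      _ ≤ (1 - σ) / 2 * 0.2529 := by
          rw [mul_assoc, e]
          gcongr
          linarith
      _ ≤ (0.107 - τ - 0.782 * τ ^ 2) * (1 + δ + δ ^ 2 / 2) := by
          refine le_of_mul_le_mul_right (a := σ ^ 2) ?_ (by positivity)
          have e2 : (0.107 - τ - 0.782 * τ ^ 2) * (1 + δ + δ ^ 2 / 2) * σ ^ 2 =
              (0.107 - τ - 0.782 * τ ^ 2) * (σ ^ 2 + (δ * σ) * σ + (δ * σ) ^ 2 / 2) := by ring
          have e3 : σ = 1 / 5 - τ := by linarith
          rw [e2, hδs, e3]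
          have h23 : 0 ≤ 8 / 115 - τ := by linarith
          nlinarith [mul_nonneg hτ0 h23, mul_nonneg (mul_nonneg hτ0 h23) hτ0,
            mul_nonneg (mul_nonneg hτ0 h23) h23,
            mul_nonneg (mul_nonneg hτ0 h23) (sq_nonneg τ),
            mul_nonneg (mul_nonneg hτ0 h23) (mul_nonneg hτ0 h23)]
  linarith

/-- The inequality in the variables `x = -log a`, `y = -log b`, `z = -log c`, when `x` is a
small part of the sum but `exp (-x)` is not close to the geometric mean. -/
lemma sum_exp_le_of_gap {x y z : ℝ} (hx : 0 < x) (hy : 0 ≤ y) (hz : 0 ≤ z)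
    (hxT : 5 * x ≤ x + y + z)
    (hgap : 0.2 ≤ x * (exp (-x) - exp (-((x + y + z) / 3)))) :
    exp (-((x + y + z) * exp (-x))) + exp (-((x + y + z) * exp (-y))) +
      exp (-((x + y + z) * exp (-z))) ≤
      3 * exp (-(x * exp (-x) + y * exp (-y) + z * exp (-z))) := by
  obtain ⟨T, hT⟩ : ∃ T, T = x + y + z := ⟨_, rfl⟩
  rw [← hT] at hxT hgap ⊢
  have hT0 : 0 < T := by linarith
  obtain ⟨n, hn⟩ : ∃ n, n = (T - x) / 2 := ⟨_, rfl⟩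
  have hn0 : 0 < n := by linarith
  obtain ⟨σ, hσ⟩ : ∃ σ, σ = x / T := ⟨_, rfl⟩
  have hσ0 : 0 < σ := by rw [hσ]; positivity
  have hσ1 : σ ≤ 1 / 5 := by rw [hσ, div_le_iff₀ hT0]; linarith
  have hσT : σ * T = x := by rw [hσ]; field_simp
  obtain ⟨r, hr⟩ : ∃ r, r = 2 / (1 - σ) := ⟨_, rfl⟩
  have h1σ : 0 < 1 - σ := by linarith
  have hr0 : 0 < r := by rw [hr]; positivity
  have hr1 : r ≤ 5 / 2 := by rw [hr, div_le_iff₀ h1σ]; linarith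
  have hrσ : r * (1 - σ) = 2 := by rw [hr]; field_simp
  have hrn : r * n = T := by
    have : n = (1 - σ) * T / 2 := by rw [hn, ← hσT]; ring
    rw [this]; linear_combination T / 2 * hrσ
  obtain ⟨N, hN⟩ : ∃ N, N = exp (-n) := ⟨_, rfl⟩
  obtain ⟨p, hp⟩ : ∃ p, p = x * (exp (-x) - N) := ⟨_, rfl⟩
  have hp0 : 0.2 ≤ p := by
    have : N ≤ exp (-(T / 3)) := by rw [hN]; exact exp_le_exp.2 (by linarith)
    rw [hp]; nlinarith
  have hscalar : p + (1 - σ) / 2 * exp (-(p / σ)) ≤ σ + log (3 / 2 * (1 - σ)) := by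
    rcases le_total σ (3 / 23) with h | h
    · refine scalar_bound_of_small hσ0 h hp0 ?_
      rw [hp]
      nlinarith [mul_exp_neg_le x, mul_pos hx (exp_pos (-n))]
    · refine scalar_bound_of_line h hσ1 hp0 ?_
      obtain ⟨-, k2, k3⟩ := gap_bound_of_ratio hx.le
      have hD := mul_exp_neg_sub_le (n := n) hx.le
      rw [← hN, ← hp] at hD
      have hσn : 2 * σ * (n - x) = x * (1 - 3 * σ) := by rw [hn, ← hσT]; ring
      refine le_of_mul_le_mul_left (a := 2 * σ) ?_ (by positivity)
      have e : 2 * σ * (x * exp (-x) * (1 - 3 * exp (-2) + exp (-2) * (n - x))) =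
          x * exp (-x) * ((1 - 3 * exp (-2)) * (2 * σ) + exp (-2) * (x * (1 - 3 * σ))) := by
        rw [← hσn]; ring
      have hD' := mul_le_mul_of_nonneg_left hD (by positivity : 0 ≤ 2 * σ)
      rw [e] at hD'
      have hlin : x * exp (-x) * ((1 - 3 * exp (-2)) * (2 * σ) + exp (-2) * (x * (1 - 3 * σ))) ≤
          ((σ - 3 / 23) * (0.4 * 0.275) + (1 / 5 - σ) * (6 / 23 * 0.36)) * (115 / 8) := by
        have a2 := mul_le_mul_of_nonneg_left k2 (sub_nonneg.2 h)
        have a3 := mul_le_mul_of_nonneg_left k3 (sub_nonneg.2 hσ1)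
        linarith
      nlinarith [mul_nonneg (sub_nonneg.2 h) (sub_nonneg.2 hσ1)]
  have hty := tangent_of_ratio_le hr0.le hr1 hn0 hy
  have htz := tangent_of_ratio_le hr0.le hr1 hn0 hz
  rw [← hN, ← mul_assoc, hrn] at hty htz
  obtain ⟨X, hX⟩ : ∃ X, X = T * N - (x * exp (-x) + y * exp (-y) + z * exp (-z)) := ⟨_, rfl⟩
  have hlogr : log (3 / 2 * (1 - σ)) = log (3 / r) := by
    congr 1; rw [hr]; field_simp
  have hexpX : r * (1 + X + log (3 / 2 * (1 - σ))) ≤ 3 * exp X := by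
    have h1 := add_one_le_exp (X + log (3 / r))
    rw [exp_add, exp_log (by positivity)] at h1
    have h2 := mul_le_mul_of_nonneg_left h1 hr0.le
    have : r * (exp X * (3 / r)) = 3 * exp X := by field_simp
    rw [hlogr]; linarith
  have hpσ : -(p / σ) = T * (N - exp (-x)) := by
    rw [hp, hσ]; field_simp; ring
  rw [hpσ] at hscalar
  have hscalar' := mul_le_mul_of_nonneg_left hscalar hr0.le
  have hrhalf : r * ((1 - σ) / 2 * exp (T * (N - exp (-x)))) = exp (T * (N - exp (-x))) := by
    linear_combination exp (T * (N - exp (-x))) / 2 * hrσ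
  have hsum : exp (T * (N - exp (-x))) + exp (T * (N - exp (-y))) + exp (T * (N - exp (-z))) ≤
      3 * exp X := by
    have hyz : r * (y * N) + r * (z * N) = 2 * (T * N) := by
      have : y + z = 2 * n := by rw [hn, hT]; ring
      linear_combination r * N * this + 2 * N * hrn
    have hxN : r * (σ * (T * N)) = r * (x * N) := by rw [← hσT]; ring
    have hTN : r * (T * N) - r * (σ * (T * N)) = 2 * (T * N) := by
      linear_combination T * N * hrσ
    have hp' : r * p = r * (x * exp (-x)) - r * (x * N) := by rw [hp]; ring
    have hX' : r * X = r * (T * N) - r * (x * exp (-x)) - r * (y * exp (-y)) -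
      r * (z * exp (-z)) := by rw [hX]; ring
    linarith
  have hmul := mul_le_mul_of_nonneg_right hsum (exp_pos (-(T * N))).le
  have e1 : ∀ w : ℝ, exp (T * (N - w)) * exp (-(T * N)) = exp (-(T * w)) := by
    intro w; rw [← exp_add]; ring_nf
  have e2 : exp X * exp (-(T * N)) =
      exp (-(x * exp (-x) + y * exp (-y) + z * exp (-z))) := by
    rw [← exp_add, hX]; ring_nf
  rw [add_mul, add_mul, e1, e1, e1, mul_assoc, e2] at hmul
  exact hmul

/-- The inequality in the variables `x = -log a`, `y = -log b`, `z = -log c`, when the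
tangent-line inequality holds for all of them. -/
lemma sum_exp_le_of_tangent {m x y z : ℝ} (hm : 3 * m = x + y + z)
    (hx : exp (3 * m * (exp (-m) - exp (-x))) ≤ 1 + 3 * x * (exp (-m) - exp (-x)))
    (hy : exp (3 * m * (exp (-m) - exp (-y))) ≤ 1 + 3 * y * (exp (-m) - exp (-y)))
    (hz : exp (3 * m * (exp (-m) - exp (-z))) ≤ 1 + 3 * z * (exp (-m) - exp (-z))) :
    exp (-((x + y + z) * exp (-x))) + exp (-((x + y + z) * exp (-y))) +
      exp (-((x + y + z) * exp (-z))) ≤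
      3 * exp (-(x * exp (-x) + y * exp (-y) + z * exp (-z))) := by
  rw [← hm]
  obtain ⟨X, hX⟩ : ∃ X, X = 3 * m * exp (-m) -
    (x * exp (-x) + y * exp (-y) + z * exp (-z)) := ⟨_, rfl⟩
  have hsum : exp (3 * m * (exp (-m) - exp (-x))) + exp (3 * m * (exp (-m) - exp (-y))) +
      exp (3 * m * (exp (-m) - exp (-z))) ≤ 3 * exp X := by
    have h1 := add_one_le_exp X
    have h2 : 3 * m * exp (-m) = (x + y + z) * exp (-m) := by rw [hm]
    linarith
  have hmul := mul_le_mul_of_nonneg_right hsum (exp_pos (-(3 * m * exp (-m)))).le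
  have e1 : ∀ w : ℝ, exp (3 * m * (exp (-m) - w)) * exp (-(3 * m * exp (-m))) =
      exp (-(3 * m * w)) := by
    intro w; rw [← exp_add]; ring_nf
  have e2 : exp X * exp (-(3 * m * exp (-m))) =
      exp (-(x * exp (-x) + y * exp (-y) + z * exp (-z))) := by
    rw [← exp_add, hX]; ring_nf
  rw [add_mul, add_mul, e1, e1, e1, mul_assoc 3 (exp X), e2] at hmul
  exact hmul

lemma tangent_or_gap {m x : ℝ} (hm : 0 < m) (hx : 0 ≤ x) :
    exp (3 * m * (exp (-m) - exp (-x))) ≤ 1 + 3 * x * (exp (-m) - exp (-x)) ∨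
      (0 < x ∧ 5 * x ≤ 3 * m ∧ 0.2 ≤ x * (exp (-x) - exp (-m))) := by
  rcases le_total m x with h | h
  · exact Or.inl (tangent_of_le hm h)
  rcases le_total (3 / 5 * m) x with h' | h'
  · exact Or.inl (tangent_of_ge_of_le hm h h')
  rcases le_total (3 * x * (exp (-x) - exp (-m))) 0.6 with h3 | h3
  · exact Or.inl (tangent_of_mul_le hm hx h' h3)
  · refine Or.inr ⟨hx.lt_of_ne ?_, by linarith, by linarith⟩
    rintro rfl
    norm_num at h3

lemma sum_exp_le {x y z : ℝ} (hx : 0 ≤ x) (hy : 0 ≤ y) (hz : 0 ≤ z) :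
    exp (-((x + y + z) * exp (-x))) + exp (-((x + y + z) * exp (-y))) +
      exp (-((x + y + z) * exp (-z))) ≤
      3 * exp (-(x * exp (-x) + y * exp (-y) + z * exp (-z))) := by
  rcases (add_nonneg (add_nonneg hx hy) hz).eq_or_lt with h0 | h0
  · have hx0 : x = 0 := by linarith
    have hy0 : y = 0 := by linarith
    have hz0 : z = 0 := by linarith
    subst hx0 hy0 hz0
    norm_num
  have hm : 0 < (x + y + z) / 3 := by positivity
  rcases tangent_or_gap hm hx with tx | ⟨g1, g2, g3⟩
  swap
  · exact sum_exp_le_of_gap g1 hy hz (by linarith) g3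
  rcases tangent_or_gap hm hy with ty | ⟨g1, g2, g3⟩
  swap
  · have h := sum_exp_le_of_gap g1 hx hz (by linarith) (by rwa [add_comm y x])
    rw [add_comm y x] at h
    rw [add_comm (x * exp (-x)) (y * exp (-y))]
    linarith
  rcases tangent_or_gap hm hz with tz | ⟨g1, g2, g3⟩
  swap
  · have e : z + x + y = x + y + z := by ring
    have h := sum_exp_le_of_gap g1 hx hy (by linarith) (by rwa [e])
    rw [e] at h
    rw [show x * exp (-x) + y * exp (-y) + z * exp (-z) =
      z * exp (-z) + x * exp (-x) + y * exp (-y) by ring]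
    linarith
  exact sum_exp_le_of_tangent (by ring) tx ty tz

theorem cirtoaje_conjecture_2_2 (a b c : ℝ) (ha0 : 0 < a) (ha1 : a ≤ 1)
    (hb0 : 0 < b) (hb1 : b ≤ 1) (hc0 : 0 < c) (hc1 : c ≤ 1) :
    3 * a ^ a * b ^ b * c ^ c ≥ (a * b * c) ^ a + (a * b * c) ^ b + (a * b * c) ^ c := by
  have h := sum_exp_le (neg_nonneg.2 (log_nonpos ha0.le ha1))
    (neg_nonneg.2 (log_nonpos hb0.le hb1)) (neg_nonneg.2 (log_nonpos hc0.le hc1))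
  simp only [neg_neg, exp_log ha0, exp_log hb0, exp_log hc0] at h
  have hlog : log (a * b * c) = log a + log b + log c := by
    rw [log_mul (by positivity) hc0.ne', log_mul ha0.ne' hb0.ne']
  have e : 3 * a ^ a * b ^ b * c ^ c = 3 * exp (-(-log a * a + -log b * b + -log c * c)) := by
    rw [rpow_def_of_pos ha0, rpow_def_of_pos hb0, rpow_def_of_pos hc0, mul_assoc, mul_assoc,
      ← exp_add, ← exp_add]
    ring_nf
  have e' : ∀ w : ℝ, (a * b * c) ^ w = exp (-((-log a + -log b + -log c) * w)) := by
    intro w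
    rw [rpow_def_of_pos (by positivity), hlog]
    ring_nf
  rw [e, e', e', e']
  exact h
end

section
/- Define g : (0, ∞) → ℝ by g(t) = exp(−(ln t)/(t − 1)) for t ≠ 1 and g(1) = exp(−1). Then g is strictly increasing on (0, ∞), and g(t) < 1 for every t > 0. -/
theorem prop_g_strictMono_lt_one
    (g : ℝ → ℝ)
    (hg : ∀ t : ℝ, g t = if t = 1 then Real.exp (-1)
      else Real.exp (-(Real.log t) / (t - 1))) :
    StrictMonoOn g (Set.Ioi (0 : ℝ)) ∧ ∀ t : ℝ, 0 < t → g t < 1 := by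
  have hlog {t : ℝ} (ht : 0 < t) (h1 : t ≠ 1) : Real.log t < t - 1 :=
    Real.log_lt_sub_one_of_pos ht h1
  refine ⟨fun x hx y hy hxy => ?_, fun t ht => ?_⟩
  · simp only [Set.mem_Ioi] at hx hy
    rw [hg, hg]
    split_ifs with h1 h2 h2
    · exact absurd (h1.trans h2.symm) hxy.ne
    · have hy1 : 0 < y - 1 := by linarith
      rw [Real.exp_lt_exp, lt_div_iff₀ hy1]
      linarith [hlog hy h2]
    · have hx1 : x - 1 < 0 := by linarith
      rw [Real.exp_lt_exp, div_lt_iff_of_neg hx1]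
      linarith [hlog hx h1]
    · have h := strictConcaveOn_log_Ioi.secant_strict_mono
        (Set.mem_Ioi.2 one_pos) hx hy h1 h2 hxy
      rw [Real.log_one, sub_zero, sub_zero] at h
      rw [Real.exp_lt_exp, neg_div, neg_div]
      exact neg_lt_neg h
  · rw [hg]
    split_ifs with h1
    · exact Real.exp_lt_one_iff.2 (by norm_num)
    · refine Real.exp_lt_one_iff.2 ?_
      rw [neg_div, neg_lt_zero]
      rcases lt_or_gt_of_ne h1 with h | h
      · exact div_pos_of_neg_of_neg (Real.log_neg ht h) (sub_neg.2 h)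
      · exact div_pos (Real.log_pos h) (sub_pos.2 h)
end

section
/- Let a, b, c, r be real numbers with a ≥ 1, 0 < b < a, 0 < c < a, and 0 ≤ r ≤ e. Then a^(r·a) + c^(r·b) ≥ a^(r·b) + c^(r·a). -/
theorem intermediate_ineq_case_b3 (a b c r : ℝ) (ha : 1 ≤ a) (hb0 : 0 < b) (hba : b < a)
    (hc0 : 0 < c) (hca : c < a) (hr0 : 0 ≤ r) (hre : r ≤ Real.exp 1) :
    a ^ (r * a) + c ^ (r * b) ≥ a ^ (r * b) + c ^ (r * a) := by
  have hexp : r * b ≤ r * a := mul_le_mul_of_nonneg_left hba.le hr0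
  rcases le_total c 1 with hc1 | hc1
  · exact add_le_add (Real.rpow_le_rpow_of_exponent_le ha hexp)
      (Real.rpow_le_rpow_of_exponent_ge hc0 hc1 hexp)
  · have hd : 0 ≤ r * a - r * b := sub_nonneg.2 hexp
    have hsplit : ∀ x : ℝ, 0 < x → x ^ (r * a) = x ^ (r * b) * x ^ (r * a - r * b) := by
      intro x hx
      rw [← Real.rpow_add hx, add_sub_cancel]
    have hmul : c ^ (r * b) * (c ^ (r * a - r * b) - 1) ≤
        a ^ (r * b) * (a ^ (r * a - r * b) - 1) :=
      mul_le_mul (Real.rpow_le_rpow hc0.le hca.le (by positivity))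
        (sub_le_sub_right (Real.rpow_le_rpow hc0.le hca.le hd) 1)
        (sub_nonneg.2 (Real.one_le_rpow hc1 hd)) (by positivity)
    rw [hsplit a (by linarith), hsplit c hc0]
    linarith
end

section
/- Let r and c be real numbers with 0 ≤ r ≤ e, 0 < c ≤ 1, and r·c ≥ r − 1. Then for every real z with c ≤ z ≤ 1, the inequality z·c^(r·z) ≥ c^(r·c + 1) holds. -/
/-- On `[c, 1]` the logarithm lies above its chord. -/
lemma one_sub_mul_log_le_one_sub_mul_log {c z : ℝ} (hc : 0 < c) (hcz : c ≤ z) (hz : z ≤ 1) :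
    (1 - z) * Real.log c ≤ (1 - c) * Real.log z := by
  rcases (hcz.trans hz).eq_or_lt with rfl | hc1
  · simp [le_antisymm hz hcz]
  have hpos : 0 < 1 - c := sub_pos.2 hc1
  have h := strictConcaveOn_log_Ioi.concaveOn.2 (Set.mem_Ioi.2 hc) (Set.mem_Ioi.2 one_pos)
    (div_nonneg (sub_nonneg.2 hz) hpos.le) (div_nonneg (sub_nonneg.2 hcz) hpos.le)
    (by field_simp; ring)
  have hcomb : (1 - z) / (1 - c) * c + (z - c) / (1 - c) * 1 = z := by field_simp; ring
  simp only [smul_eq_mul, hcomb, Real.log_one, mul_zero, add_zero] at h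
  rwa [div_mul_eq_mul_div, div_le_iff₀ hpos, mul_comm (Real.log z)] at h

theorem aux_m_nonneg (r c : ℝ) (hr0 : 0 ≤ r) (hre : r ≤ Real.exp 1)
    (hc0 : 0 < c) (hc1 : c ≤ 1) (hrc : r * c ≥ r - 1) :
    ∀ z : ℝ, c ≤ z → z ≤ 1 → z * c ^ (r * z) ≥ c ^ (r * c + 1) := by
  intro z hcz hz1
  rcases hc1.eq_or_lt with rfl | hc1
  · simpa using hcz
  have hz0 : 0 < z := hc0.trans_le hcz
  have hchord := one_sub_mul_log_le_one_sub_mul_log hc0 hcz hz1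
  have hslack : 0 ≤ (z - c) * (-Real.log c) * (r * c - (r - 1)) :=
    mul_nonneg (mul_nonneg (sub_nonneg.2 hcz) (neg_nonneg.2 (Real.log_nonpos hc0.le hc1.le)))
      (sub_nonneg.2 hrc)
  have hlog : Real.log c * (r * c + 1) ≤ Real.log z + Real.log c * (r * z) :=
    le_of_mul_le_mul_left (by linarith) (sub_pos.2 hc1)
  calc c ^ (r * c + 1) = Real.exp (Real.log c * (r * c + 1)) := Real.rpow_def_of_pos hc0 _
    _ ≤ Real.exp (Real.log z + Real.log c * (r * z)) := Real.exp_le_exp.2 hlog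
    _ = z * c ^ (r * z) := by
      rw [Real.exp_add, Real.exp_log hz0, Real.rpow_def_of_pos hc0]
end

section
/- Let r and c be real numbers with 1 < r ≤ e, 0 < c ≤ 1, and r·c ≤ r − 1. Then for every real z with c ≤ z ≤ 1, the inequality c^((1−r)·z) · z^c ≥ c^(c + c·(1−r)) holds. -/
theorem aux_q_nonneg (r c : ℝ) (hr1 : 1 < r) (hre : r ≤ Real.exp 1)
    (hc0 : 0 < c) (hc1 : c ≤ 1) (hrc : r * c ≤ r - 1) :
    ∀ z : ℝ, c ≤ z → z ≤ 1 →
      c ^ ((1 - r) * z) * z ^ c ≥ c ^ (c + c * (1 - r)) := by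
  intro z hcz _
  have hexp : c ^ (c * (1 - r)) ≤ c ^ ((1 - r) * z) :=
    Real.rpow_le_rpow_of_exponent_ge hc0 hc1 (by nlinarith)
  have hbase : c ^ c ≤ z ^ c := Real.rpow_le_rpow hc0.le hcz hc0.le
  rw [ge_iff_le, Real.rpow_add hc0, mul_comm]
  gcongr
end

section
/- For every real number b with 0 < b < 1 and every real number r with 0 < r ≤ e, the inequality b^(r·b/2) > b^r · ln b + b holds. -/
theorem K_one_gt_Q_one (b r : ℝ) (hb0 : 0 < b) (hb1 : b < 1)
    (hr0 : 0 < r) (hre : r ≤ Real.exp 1) :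
    b ^ (r * b / 2) > b ^ r * Real.log b + b := by
  have hlog : Real.log b < 0 := Real.log_neg hb0 hb1
  rcases le_or_gt (r * b) 2 with hrb | hrb
  · have hle : b ^ (1 : ℝ) ≤ b ^ (r * b / 2) :=
      Real.rpow_le_rpow_of_exponent_ge hb0 hb1.le (by linarith)
    rw [Real.rpow_one] at hle
    have hneg : b ^ r * Real.log b < 0 := mul_neg_of_pos_of_neg (by positivity) hlog
    linarith
  · -- Divide by `b` and bound both powers below by `1 + x ≤ exp x`.
    have hpow (x : ℝ) : b * (1 + Real.log b * (x - 1)) ≤ b ^ x := by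
      have hexp := Real.add_one_le_exp (Real.log b * (x - 1))
      rw [← Real.rpow_def_of_pos hb0, Real.rpow_sub_one hb0.ne', le_div_iff₀ hb0] at hexp
      linarith
    have hr : r < 2.7182818286 := hre.trans_lt Real.exp_one_lt_d9
    have hr2 : 2 < r := by nlinarith
    have hinv : 1 - r / 2 < Real.log b := by
      have hb : b⁻¹ < r / 2 := by
        rw [inv_lt_iff_one_lt_mul₀ hb0]
        linarith
      linarith [Real.one_sub_inv_le_log_of_pos hb0]
    have hkey : r * b / 2 - 1 < 1 + Real.log b * (r - 1) := by nlinarith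
    have hmul := mul_le_mul_of_nonpos_right (hpow r) hlog.le
    have hprod := mul_neg_of_neg_of_pos (mul_neg_of_pos_of_neg hb0 hlog) (sub_pos.2 hkey)
    linarith [hpow (r * b / 2)]
end

section
/- Let b and r be real numbers with 0 < b ≤ 1 and 0 < r ≤ e. Then the function K defined on (0,1] by K(x) = √(x^(r·x) · b^(r·b)) · (ln x + 1) is strictly increasing on (0,1]. -/
/-- The exponential form of `x ↦ √(x ^ (r * x)) * (log x + 1)` is strictly increasing. -/
theorem strictMonoOn_exp_mul_log_mul_log_add_one {r : ℝ} (hr : 0 ≤ r) :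
    StrictMonoOn (fun x : ℝ => Real.exp (r / 2 * (x * Real.log x)) * (Real.log x + 1))
      (Set.Ioi 0) := by
  have hderiv : ∀ x ∈ Set.Ioi (0 : ℝ),
      HasDerivAt (fun x : ℝ => Real.exp (r / 2 * (x * Real.log x)) * (Real.log x + 1))
        (Real.exp (r / 2 * (x * Real.log x)) * (r / 2 * (Real.log x + 1) ^ 2 + x⁻¹)) x := by
    intro x hx
    have hx0 : x ≠ 0 := ne_of_gt hx
    convert! ((Real.hasDerivAt_mul_log hx0).const_mul (r / 2)).exp.mul
      ((Real.hasDerivAt_log hx0).add_const 1) using 1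
    ring
  refine strictMonoOn_of_deriv_pos (convex_Ioi 0)
    (fun x hx => (hderiv x hx).continuousAt.continuousWithinAt) fun x hx => ?_
  rw [interior_Ioi] at hx
  rw [(hderiv x hx).deriv]
  have : 0 < x := hx
  positivity

theorem sqrt_rpow_mul_self {x : ℝ} (hx : 0 < x) (r : ℝ) :
    Real.sqrt (x ^ (r * x)) = Real.exp (r / 2 * (x * Real.log x)) := by
  rw [Real.rpow_def_of_pos hx, ← Real.exp_half]
  ring_nf

theorem K_strictMono (b r : ℝ) (hb0 : 0 < b) (hb1 : b ≤ 1)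
    (hr0 : 0 < r) (hre : r ≤ Real.exp 1) :
    StrictMonoOn (fun x : ℝ => Real.sqrt (x ^ (r * x) * b ^ (r * b)) * (Real.log x + 1))
      (Set.Ioc 0 1) := by
  have hC : 0 < Real.sqrt (b ^ (r * b)) := Real.sqrt_pos.2 (Real.rpow_pos_of_pos hb0 _)
  refine StrictMonoOn.congr (f₁ := fun x : ℝ => Real.sqrt (b ^ (r * b)) *
    (Real.exp (r / 2 * (x * Real.log x)) * (Real.log x + 1))) ?_ fun x hx => ?_
  · intro x hx y hy hxy
    exact mul_lt_mul_of_pos_left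
      (strictMonoOn_exp_mul_log_mul_log_add_one hr0.le hx.1 hy.1 hxy) hC
  · dsimp only
    rw [Real.sqrt_mul (Real.rpow_nonneg hx.1.le _), sqrt_rpow_mul_self hx.1]
    ring
end
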